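/- arXiv:1704.03698 — 2 statements merged into one kernel-verified Lean document; each statement's English description precedes it below -/
import Mathlib

section
/- Let u, w : ℝ³ → ℝ be functions continuous in all variables and locally Lipschitz in (q,p), with w(0,0,t) < 1 and w(π,0,t) > −1 for all t. Let μ = (q*, 0) with 0 < q* < π be an equilibrium of the system q̇ = p, ṗ = u(q,p,t)·sin q − cos q + w(q,p,t), and let t₀ ∈ ℝ. Suppose there exists a Lyapunov function V satisfying conditions L1 and L2 (with the derivative taken along this vector field) on a closed set U ⊆ M containing μ in its interior. Then there exist an initial condition (q₀, p₀) with 0 < q₀ < π and an open neighborhood B ⊆ M of μ such that every solution with (q(t₀), p(t₀)) = (q₀, p₀) satisfies 0 < q(t) < π and (q(t), p(t)) ∉ B for all t ≥ t₀ in its interval of existence. -/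
open Real Set

noncomputable def clampSq (R : ℝ) (z : ℝ × ℝ) : ℝ × ℝ :=
  (max (-R) (min R z.1), max (-R) (min R z.2))

theorem clampSq_lip (R : ℝ) : LipschitzWith 1 (clampSq R) := by
  have key : ∀ a b : ℝ, |max (-R) (min R a) - max (-R) (min R b)| ≤ |a - b| := by
    intro a b
    have h1 := abs_max_sub_max_le_abs (min R a) (min R b) (-R)
    have h2 := abs_min_sub_min_le_max R a R b
    have h3 : max |R - R| |a - b| = |a - b| := by simp
    rw [max_comm (-R), max_comm (-R)]
    linarith
  apply LipschitzWith.of_dist_le_mul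
  intro x y
  simp only [clampSq, Prod.dist_eq, Real.dist_eq, NNReal.coe_one, one_mul]
  exact max_le_max (key _ _) (key _ _)

theorem clampSq_mem {R : ℝ} (hR : 0 ≤ R) (z : ℝ × ℝ) :
    clampSq R z ∈ Metric.closedBall (0 : ℝ × ℝ) R := by
  have key : ∀ a : ℝ, |max (-R) (min R a)| ≤ R := by
    intro a
    rw [abs_le]
    exact ⟨le_max_left _ _, max_le (by linarith) (min_le_left _ _)⟩
  simp only [clampSq, Metric.mem_closedBall, Prod.dist_eq, Real.dist_eq, Prod.fst_zero,
    Prod.snd_zero, sub_zero]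
  exact max_le (key _) (key _)

theorem clampSq_eq {R : ℝ} {z : ℝ × ℝ} (hz : z ∈ Metric.closedBall (0 : ℝ × ℝ) R) :
    clampSq R z = z := by
  simp only [Metric.mem_closedBall, Prod.dist_eq, Real.dist_eq, Prod.fst_zero,
    Prod.snd_zero, sub_zero, max_le_iff, abs_le] at hz
  obtain ⟨⟨h1, h2⟩, h3, h4⟩ := hz
  simp only [clampSq]
  rw [min_eq_right h2, min_eq_right h4, max_eq_right h1, max_eq_right h3]

theorem gron {v : ℝ → ℝ × ℝ → ℝ × ℝ} {L : NNReal} {a b : ℝ} {x y : ℝ → ℝ × ℝ}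
    (hv : ∀ t ∈ Icc a b, LipschitzWith L (v t))
    (hx : IsIntegralCurveOn x v (Icc a b)) (hy : IsIntegralCurveOn y v (Icc a b)) :
    ∀ t ∈ Icc a b, dist (x t) (y t) ≤ dist (x a) (y a) * exp (L * (t - a)) := by
  have aux : ∀ {x : ℝ → ℝ × ℝ}, IsIntegralCurveOn x v (Icc a b) →
      ∀ t ∈ Ico a b, HasDerivWithinAt x (v t (x t)) (Ici t) t := fun h t ht =>
    (h t (Ico_subset_Icc_self ht)).mono_of_mem_nhdsWithin (Icc_mem_nhdsGE_of_mem ht)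
  exact dist_le_of_trajectories_ODE_of_mem (s := fun _ => univ)
    (fun t ht => (hv t (Ico_subset_Icc_self ht)).lipschitzOnWith)
    (HasDerivWithinAt.continuousOn hx) (aux hx) (fun _ _ => trivial)
    (HasDerivWithinAt.continuousOn hy) (aux hy) (fun _ _ => trivial) le_rfl

/-- Regularity assumption on the field. -/
structure NiceField (F : ℝ → ℝ × ℝ → ℝ × ℝ) : Prop where
  cont : Continuous fun a : ℝ × ℝ × ℝ => F a.1 a.2
  lip : ∀ R : ℝ, ∃ L : NNReal, ∀ t, |t| ≤ R → LipschitzOnWith L (F t) (Metric.closedBall 0 R)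

theorem NiceField.flow {F : ℝ → ℝ × ℝ → ℝ × ℝ} (hF : NiceField F) {R a b : ℝ} (hR : 0 ≤ R)
    (ha : |a| ≤ R) (hb : |b| ≤ R) (hab : a ≤ b) :
    ∃ L : NNReal, (∀ t ∈ Icc a b, LipschitzWith L (fun z => F t (clampSq R z))) ∧
      ∀ z, ∃ y : ℝ → ℝ × ℝ, y a = z ∧
        IsIntegralCurveOn y (fun t z => F t (clampSq R z)) (Icc a b) := by
  obtain ⟨L, hL⟩ := hF.lip R
  have htR : ∀ t ∈ Icc a b, |t| ≤ R := by
    intro t ht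
    rw [abs_le] at *
    exact ⟨by linarith [ht.1], by linarith [ht.2]⟩
  have hlip : ∀ t ∈ Icc a b, LipschitzWith L (fun z => F t (clampSq R z)) := by
    intro t ht
    have h := (hL t (htR t ht)).comp (clampSq_lip R).lipschitzOnWith
      (s := univ) (fun z _ => clampSq_mem hR z)
    rw [mul_one, lipschitzOnWith_univ] at h
    exact h
  refine ⟨L, hlip, fun z => ?_⟩
  have hcomp : IsCompact (Icc a b ×ˢ Metric.closedBall (0 : ℝ × ℝ) R) :=
    isCompact_Icc.prod (isCompact_closedBall _ _)
  obtain ⟨C, hC⟩ := hcomp.exists_bound_of_continuousOn hF.cont.continuousOn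
  have hpl : IsPicardLindelof (fun t z => F t (clampSq R z))
      (⟨a, left_mem_Icc.2 hab⟩ : Icc a b) z (C.toNNReal * (b - a).toNNReal) 0 C.toNNReal L := by
    refine ⟨fun t ht => (hlip t ht).lipschitzOnWith, fun x _ => ?_, fun t ht x _ => ?_, ?_⟩
    · have : Continuous fun t : ℝ => F t (clampSq R x) :=
        hF.cont.comp (by fun_prop : Continuous fun t : ℝ => (t, clampSq R x))
      exact this.continuousOn
    · exact (hC (t, clampSq R x) ⟨ht, clampSq_mem hR x⟩).trans (Real.le_coe_toNNReal C)
    · simp [hab]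
  obtain ⟨y, hy0, hy⟩ := hpl.exists_eq_forall_mem_Icc_hasDerivWithinAt₀
  exact ⟨y, hy0, hy⟩

theorem NiceField.bound {F : ℝ → ℝ × ℝ → ℝ × ℝ} {a b : ℝ} {x : ℝ → ℝ × ℝ}
    (hx : IsIntegralCurveOn x F (Icc a b)) :
    ∃ R : ℝ, 0 ≤ R ∧ |a| ≤ R ∧ |b| + 1 ≤ R ∧
      ∀ t ∈ Icc a b, x t ∈ Metric.closedBall (0 : ℝ × ℝ) (R - 1) := by
  obtain ⟨C, hC⟩ := isCompact_Icc.exists_bound_of_continuousOn (HasDerivWithinAt.continuousOn hx)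
  refine ⟨|a| + |b| + |C| + 1, by positivity, ?_, ?_, fun t ht => ?_⟩
  · linarith [abs_nonneg b, abs_nonneg C]
  · linarith [abs_nonneg a, abs_nonneg C]
  · rw [mem_closedBall_zero_iff]
    linarith [abs_nonneg a, abs_nonneg b, le_abs_self C, hC t ht]

theorem curve_clamp {F : ℝ → ℝ × ℝ → ℝ × ℝ} {a b R : ℝ} {x : ℝ → ℝ × ℝ}
    (h : ∀ t ∈ Icc a b, x t ∈ Metric.closedBall (0 : ℝ × ℝ) R) :
    IsIntegralCurveOn x F (Icc a b) ↔
      IsIntegralCurveOn x (fun t z => F t (clampSq R z)) (Icc a b) := by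
  unfold IsIntegralCurveOn
  refine forall₂_congr fun t ht => ?_
  simp only [clampSq_eq (h t ht)]

theorem NiceField.dep {F : ℝ → ℝ × ℝ → ℝ × ℝ} (hF : NiceField F) {a b : ℝ} {x : ℝ → ℝ × ℝ}
    (hab : a ≤ b) (hx : IsIntegralCurveOn x F (Icc a b)) {η : ℝ} (hη : 0 < η) :
    ∃ δ > 0, ∀ z, dist z (x a) < δ → ∃ y, y a = z ∧ IsIntegralCurveOn y F (Icc a b) ∧
      ∀ t ∈ Icc a b, dist (y t) (x t) < η := by
  obtain ⟨R, hR, haR, hbR, hxR⟩ := NiceField.bound hx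
  obtain ⟨L, hL, hflow⟩ := hF.flow hR haR (by linarith) hab
  have hx' := (curve_clamp (R := R) fun t ht =>
    Metric.closedBall_subset_closedBall (by linarith) (hxR t ht)).1 hx
  have hE : 0 < exp (L * (b - a)) := exp_pos _
  refine ⟨min η 1 / exp (L * (b - a)), by positivity, fun z hz => ?_⟩
  obtain ⟨y, hy0, hy⟩ := hflow z
  have hd : ∀ t ∈ Icc a b, dist (y t) (x t) < min η 1 := by
    intro t ht
    refine (gron hL hy hx' t ht).trans_lt ?_
    rw [hy0]
    rw [lt_div_iff₀ hE] at hz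
    refine lt_of_le_of_lt ?_ hz
    gcongr
    exact ht.2
  refine ⟨y, hy0, (curve_clamp fun t ht => ?_).2 hy, fun t ht => (hd t ht).trans_le (min_le_left _ _)⟩
  have h1 := hxR t ht
  have h2 := (hd t ht).trans_le (min_le_right _ _)
  rw [Metric.mem_closedBall] at *
  linarith [dist_triangle (y t) (x t) 0]

theorem NiceField.unique {F : ℝ → ℝ × ℝ → ℝ × ℝ} (hF : NiceField F) {a b : ℝ} {x y : ℝ → ℝ × ℝ}
    (hab : a ≤ b) (hx : IsIntegralCurveOn x F (Icc a b)) (hy : IsIntegralCurveOn y F (Icc a b))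
    (h0 : x a = y a) : ∀ t ∈ Icc a b, x t = y t := by
  obtain ⟨R, hR, haR, hbR, hxR⟩ := NiceField.bound hx
  obtain ⟨R', hR', haR', hbR', hyR⟩ := NiceField.bound hy
  obtain ⟨L, hL, -⟩ := hF.flow (R := max R R') (hR.trans (le_max_left _ _))
    (haR.trans (le_max_left _ _)) (by linarith [le_max_left R R']) hab
  have hx' := (curve_clamp (R := max R R') fun t ht =>
    Metric.closedBall_subset_closedBall (by linarith [le_max_left R R']) (hxR t ht)).1 hx
  have hy' := (curve_clamp (R := max R R') fun t ht =>
    Metric.closedBall_subset_closedBall (by linarith [le_max_right R R']) (hyR t ht)).1 hy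
  intro t ht
  have := gron hL hx' hy' t ht
  rw [h0, dist_self, zero_mul] at this
  exact dist_le_zero.1 this

theorem NiceField.extend {F : ℝ → ℝ × ℝ → ℝ × ℝ} (hF : NiceField F) {a b : ℝ} {x : ℝ → ℝ × ℝ}
    (hab : a ≤ b) (hx : IsIntegralCurveOn x F (Icc a b)) :
    ∃ c > b, ∃ y, IsIntegralCurveOn y F (Icc a c) ∧ ∀ t ∈ Icc a b, y t = x t := by
  obtain ⟨R, hR, haR, hbR, hxR⟩ := NiceField.bound hx
  have hb1 : |b + 1| ≤ R := by
    have := abs_add_le b 1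
    rw [abs_one] at this
    linarith
  obtain ⟨L, hL, hflow⟩ := hF.flow hR haR hb1 (by linarith)
  have hx' := (curve_clamp (R := R) fun t ht =>
    Metric.closedBall_subset_closedBall (by linarith) (hxR t ht)).1 hx
  obtain ⟨y, hy0, hy⟩ := hflow (x a)
  have hsub : Icc a b ⊆ Icc a (b + 1) := Icc_subset_Icc_right (by linarith)
  have heq : ∀ t ∈ Icc a b, y t = x t := by
    intro t ht
    have := gron (fun t ht => hL t (hsub ht)) (hy.mono hsub) hx' t ht
    rw [hy0, dist_self, zero_mul] at this
    exact dist_le_zero.1 this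
  have hbm : b ∈ Icc a b := right_mem_Icc.2 hab
  have hc : ContinuousWithinAt y (Icc a (b + 1)) b := (hy b (hsub hbm)).continuousWithinAt
  have hball : Metric.ball (0 : ℝ × ℝ) R ∈ nhds (y b) := by
    apply Metric.isOpen_ball.mem_nhds
    rw [heq b hbm]
    exact Metric.closedBall_subset_ball (by linarith) (hxR b hbm)
  obtain ⟨ε, hε, hεs⟩ := Metric.mem_nhdsWithin_iff.1 (hc hball)
  refine ⟨b + min 1 (ε / 2), by simp [hε], y, (curve_clamp fun t ht => ?_).2
    (hy.mono (Icc_subset_Icc_right (by linarith [min_le_left 1 (ε / 2)]))), heq⟩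
  rcases le_total t b with h | h
  · rw [heq t ⟨ht.1, h⟩]
    exact Metric.closedBall_subset_closedBall (by linarith) (hxR t ⟨ht.1, h⟩)
  · apply Metric.ball_subset_closedBall
    apply hεs
    refine ⟨?_, ht.1, by linarith [ht.2, min_le_left 1 (ε / 2)]⟩
    rw [Metric.mem_ball, Real.dist_eq, abs_of_nonneg (by linarith)]
    linarith [ht.2, min_le_right 1 (ε / 2)]

theorem curve_fst {y : ℝ → ℝ × ℝ} {v : ℝ × ℝ} {S : Set ℝ} {t : ℝ}
    (h : HasDerivWithinAt y v S t) : HasDerivWithinAt (fun t => (y t).1) v.1 S t :=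
  (ContinuousLinearMap.fst ℝ ℝ ℝ).hasFDerivAt.comp_hasDerivWithinAt t h

theorem curve_snd {y : ℝ → ℝ × ℝ} {v : ℝ × ℝ} {S : Set ℝ} {t : ℝ}
    (h : HasDerivWithinAt y v S t) : HasDerivWithinAt (fun t => (y t).2) v.2 S t :=
  (ContinuousLinearMap.snd ℝ ℝ ℝ).hasFDerivAt.comp_hasDerivWithinAt t h

/-- Initial conditions (at time `a`) of curves which reach `O` at some time staying in `P`. -/
def Reach (F : ℝ → ℝ × ℝ → ℝ × ℝ) (a : ℝ) (O P : Set (ℝ × ℝ)) : Set (ℝ × ℝ) :=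
  {z | ∃ T, a ≤ T ∧ ∃ x : ℝ → ℝ × ℝ, x a = z ∧ IsIntegralCurveOn x F (Icc a T) ∧ x T ∈ O ∧
    ∀ t ∈ Icc a T, x t ∈ P}

theorem NiceField.isOpen_reach {F : ℝ → ℝ × ℝ → ℝ × ℝ} (hF : NiceField F) (a : ℝ)
    {O P : Set (ℝ × ℝ)} (hO : IsOpen O) (hP : IsOpen P) : IsOpen (Reach F a O P) := by
  rw [Metric.isOpen_iff]
  rintro z ⟨T, haT, x, rfl, hx, hxO, hxP⟩
  have hcomp : IsCompact (x '' Icc a T) :=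
    isCompact_Icc.image_of_continuousOn (HasDerivWithinAt.continuousOn hx)
  obtain ⟨η₁, hη₁, h1⟩ := hcomp.exists_thickening_subset_open hP (image_subset_iff.2 hxP)
  obtain ⟨η₂, hη₂, h2⟩ := Metric.isOpen_iff.1 hO _ hxO
  obtain ⟨δ, hδ, H⟩ := hF.dep haT hx (lt_min hη₁ hη₂)
  refine ⟨δ, hδ, fun z hz => ?_⟩
  obtain ⟨y, hy0, hy, hd⟩ := H z hz
  refine ⟨T, haT, y, hy0, hy, h2 ?_, fun t ht => h1 ?_⟩
  · exact (hd T (right_mem_Icc.2 haT)).trans_le (min_le_right _ _)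
  · rw [Metric.mem_thickening_iff]
    exact ⟨x t, mem_image_of_mem x ht, (hd t ht).trans_le (min_le_left _ _)⟩

theorem NiceField.disjoint_reach {F : ℝ → ℝ × ℝ → ℝ × ℝ} (hF : NiceField F) {a : ℝ}
    {O P O' P' : Set (ℝ × ℝ)}
    (h1 : ∀ x T T', a ≤ T → T ≤ T' → IsIntegralCurveOn x F (Icc a T') → x T ∈ O → x T' ∈ O' →
      x T ∈ P' → False)
    (h2 : ∀ x T T', a ≤ T → T ≤ T' → IsIntegralCurveOn x F (Icc a T') → x T ∈ O' → x T' ∈ O →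
      x T ∈ P → False) (z : ℝ × ℝ) (hz : z ∈ Reach F a O P) (hz' : z ∈ Reach F a O' P') :
    False := by
  obtain ⟨T, haT, x, hx0, hx, hxO, hxP⟩ := hz
  obtain ⟨T', haT', x', hx0', hx', hxO', hxP'⟩ := hz'
  rcases le_total T T' with h | h
  · have e := hF.unique haT hx (hx'.mono (Icc_subset_Icc_right h)) (hx0.trans hx0'.symm) T ⟨haT, le_rfl⟩
    exact h1 x' T T' haT h hx' (e ▸ hxO) hxO' (hxP' T ⟨haT, h⟩)
  · have e := hF.unique haT' hx' (hx.mono (Icc_subset_Icc_right h)) (hx0'.trans hx0.symm) T' ⟨haT', le_rfl⟩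
    exact h2 x T' T haT' h hx (e ▸ hxO') hxO (hxP T' ⟨haT', h⟩)

theorem NiceField.leaves {F : ℝ → ℝ × ℝ → ℝ × ℝ} (hF : NiceField F) {a T : ℝ} (haT : a ≤ T)
    {P : Set (ℝ × ℝ)} (hP : IsOpen P) {x : ℝ → ℝ × ℝ} (hx : IsIntegralCurveOn x F (Icc a T))
    (hxP : ∀ t ∈ Icc a T, x t ∈ P) {s k : ℝ} (h0 : s * ((x T).1 - k) = 0)
    (hd : s * (F T (x T)).1 < 0) : x a ∈ Reach F a {z | s * (z.1 - k) < 0} P := by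
  obtain ⟨c, hc, y, hy, hyx⟩ := hF.extend haT hx
  have hTm : T ∈ Icc a T := ⟨haT, le_rfl⟩
  have hyT := hy T ⟨haT, hc.le⟩
  have hTc : Icc a c ∈ nhdsWithin T (Ici T) := Icc_mem_nhdsGE_of_mem ⟨haT, hc⟩
  have hyT' := (hyT.mono_of_mem_nhdsWithin hTc)
  have hφ : HasDerivWithinAt (fun t => s * ((y t).1 - k)) (s * (F T (y T)).1) (Ici T) T :=
    ((curve_fst hyT').sub_const k).const_mul s
  rw [hasDerivWithinAt_iff_tendsto_slope] at hφ
  rw [hyx T hTm] at hφ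
  have e1 := hφ.eventually (Iio_mem_nhds hd)
  rw [Ici_sdiff_left] at e1
  have e2 : ∀ᶠ t in nhdsWithin T (Ioi T), y t ∈ P := by
    apply (hyT'.continuousWithinAt.mono Ioi_subset_Ici_self)
    exact hP.mem_nhds (hyx T hTm ▸ hxP T hTm)
  have e3 : ∀ᶠ t in nhdsWithin T (Ioi T), t ∈ Ioo T c := Ioo_mem_nhdsGT hc
  have e4 := (e1.and (e2.and e3))
  obtain ⟨c', hc', hsub⟩ := (mem_nhdsGT_iff_exists_Ioo_subset).1 e4
  rw [mem_Ioi] at hc'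
  set T' := (T + c') / 2 with hT'
  have hm : T' ∈ Ioo T c' := ⟨by rw [hT']; linarith, by rw [hT']; linarith⟩
  obtain ⟨g1, g2, g3⟩ := hsub hm
  refine ⟨T', by linarith [hm.1], y, hyx a ⟨le_rfl, haT⟩, hy.mono (Icc_subset_Icc_right g3.2.le),
    ?_, ?_⟩
  · rw [slope_def_field, hyx T hTm, h0, sub_zero] at g1
    have := (div_neg_iff.1 g1)
    rcases this with h | h
    · linarith [h.2, hm.1]
    · exact h.1
  · intro t ht
    rcases le_or_gt t T with h | h
    · rw [hyx t ⟨ht.1, h⟩]; exact hxP t ⟨ht.1, h⟩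
    · exact (hsub ⟨h, by linarith [ht.2, hm.2]⟩).2.1

theorem boundary_sign {q p : ℝ → ℝ} {a T α : ℝ} (haT : a < T)
    (hq : ∀ t ∈ Icc a T, HasDerivWithinAt q (p t) (Icc a T) t)
    (hp : HasDerivWithinAt p α (Icc a T) T) (hpos : ∀ t ∈ Ico a T, 0 < q t) (h0 : q T = 0)
    (hα : p T = 0 → α < 0) : p T < 0 := by
  by_contra hcon
  have hIcc : Icc a T ∈ nhdsWithin T (Iic T) := Icc_mem_nhdsLE_of_mem ⟨haT, le_rfl⟩
  have hp' := hp.mono_of_mem_nhdsWithin hIcc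
  have ev : ∀ᶠ t in nhdsWithin T (Iio T), 0 < p t := by
    rcases lt_or_eq_of_le (not_lt.1 hcon) with h | h
    · exact (hp'.continuousWithinAt.mono Iio_subset_Iic_self).eventually (lt_mem_nhds h)
    · rw [hasDerivWithinAt_iff_tendsto_slope, Iic_sdiff_right] at hp'
      filter_upwards [hp'.eventually (Iio_mem_nhds (hα h.symm)), self_mem_nhdsWithin] with t ht htT
      rw [slope_def_field, ← h, sub_zero] at ht
      rw [mem_Iio] at htT
      rcases div_neg_iff.1 ht with h | h
      · exact h.1
      · linarith [h.2]
  obtain ⟨c, hc, hsub⟩ := (mem_nhdsLT_iff_exists_Ioo_subset).1 ev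
  rw [mem_Iio] at hc
  set d := max a c with hd
  have hdT : d < T := max_lt haT hc
  have had : a ≤ d := le_max_left _ _
  have hss : Icc d T ⊆ Icc a T := Icc_subset_Icc_left had
  have hmono : StrictMonoOn q (Icc d T) := by
    apply strictMonoOn_of_deriv_pos (convex_Icc d T)
    · exact (HasDerivWithinAt.continuousOn hq).mono hss
    · intro t ht
      rw [interior_Icc] at ht
      have := (hq t (hss (Ioo_subset_Icc_self ht))).hasDerivAt
        (Icc_mem_nhds (by linarith [ht.1]) ht.2)
      rw [this.deriv]
      exact hsub ⟨(le_max_right a c).trans_lt ht.1, ht.2⟩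
  have := hmono (left_mem_Icc.2 hdT.le) (right_mem_Icc.2 hdT.le) hdT
  linarith [hpos d ⟨had, hdT⟩]

/-- The first time at which a closed condition is met. -/
theorem first_time {x : ℝ → ℝ × ℝ} {a b : ℝ} (hx : ContinuousOn x (Icc a b)) (hab : a ≤ b)
    {P : Set (ℝ × ℝ)} (hP : IsOpen P) (hb : x b ∉ P) :
    ∃ T ∈ Icc a b, x T ∉ P ∧ ∀ t ∈ Ico a T, x t ∈ P := by
  have hcl : IsClosed (Icc a b ∩ x ⁻¹' Pᶜ) := hx.preimage_isClosed_of_isClosed isClosed_Icc hP.isClosed_compl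
  have hcpt : IsCompact (Icc a b ∩ x ⁻¹' Pᶜ) := isCompact_Icc.of_isClosed_subset hcl inter_subset_left
  obtain ⟨T, hT, hmin⟩ := hcpt.exists_isLeast ⟨b, ⟨hab, le_rfl⟩, hb⟩
  refine ⟨T, hT.1, hT.2, fun t ht => ?_⟩
  by_contra h
  exact absurd (hmin ⟨⟨ht.1, ht.2.le.trans hT.1.2⟩, h⟩) (not_le.2 ht.2)

theorem trap {F : ℝ → ℝ × ℝ → ℝ × ℝ} {V : ℝ × ℝ → ℝ} {DV : ℝ × ℝ → (ℝ × ℝ) →L[ℝ] ℝ}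
    {m : ℝ × ℝ} {r c : ℝ}
    (hV : ∀ z ∈ Metric.closedBall m r, HasFDerivAt V (DV z) z)
    (hneg : ∀ t, ∀ z ∈ Metric.closedBall m r, DV z (F t z) ≤ 0)
    (hc : ∀ z ∈ Metric.sphere m r, c ≤ V z)
    (hO : IsOpen (Metric.ball m r ∩ {z | V z < c}))
    {x : ℝ → ℝ × ℝ} {a b : ℝ} (hab : a ≤ b) (hx : IsIntegralCurveOn x F (Icc a b))
    (ha : x a ∈ Metric.ball m r ∩ {z | V z < c}) : x b ∈ Metric.ball m r ∩ {z | V z < c} := by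
  by_contra hb
  have hxc : ContinuousOn x (Icc a b) := HasDerivWithinAt.continuousOn hx
  obtain ⟨T, hT, hTn, hTI⟩ := first_time hxc hab hO hb
  have haT : a < T := lt_of_le_of_ne hT.1 (fun h => hTn (h ▸ ha))
  have hss : Icc a T ⊆ Icc a b := Icc_subset_Icc_right hT.2
  have hxT : x T ∈ Metric.closedBall m r := by
    have hcw : ContinuousWithinAt x (Ico a T) T := (hxc T hT).mono (Ico_subset_Icc_self.trans hss)
    have := hcw.mem_closure (t := Metric.closedBall m r)
      (by rw [closure_Ico haT.ne]; exact ⟨haT.le, le_rfl⟩)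
      (fun t ht => Metric.ball_subset_closedBall (hTI t ht).1)
    rwa [Metric.isClosed_closedBall.closure_eq] at this
  have hin : ∀ t ∈ Icc a T, x t ∈ Metric.closedBall m r := by
    intro t ht
    rcases lt_or_eq_of_le ht.2 with h | h
    · exact Metric.ball_subset_closedBall (hTI t ⟨ht.1, h⟩).1
    · exact h ▸ hxT
  have hd : ∀ t ∈ Icc a T, HasDerivWithinAt (fun t => V (x t)) (DV (x t) (F t (x t))) (Icc a T) t :=
    fun t ht => (hV _ (hin t ht)).comp_hasDerivWithinAt t ((hx t (hss ht)).mono hss)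
  have hd' : ∀ t ∈ interior (Icc a T), HasDerivAt (fun t => V (x t)) (DV (x t) (F t (x t))) t := by
    intro t ht
    have ht' := interior_subset ht
    exact (hd t ht').hasDerivAt (mem_interior_iff_mem_nhds.1 ht)
  have hanti : AntitoneOn (fun t => V (x t)) (Icc a T) :=
    antitoneOn_of_deriv_nonpos (convex_Icc a T) (HasDerivWithinAt.continuousOn hd)
      (fun t ht => (hd' t ht).differentiableAt.differentiableWithinAt)
      (fun t ht => by rw [(hd' t ht).deriv]; exact hneg t _ (hin t (interior_subset ht)))
  have hle : V (x T) ≤ V (x a) := hanti ⟨le_rfl, haT.le⟩ ⟨haT.le, le_rfl⟩ haT.le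
  have hlt : V (x T) < c := hle.trans_lt ha.2
  rcases lt_or_eq_of_le (Metric.mem_closedBall.1 hxT) with h | h
  · exact hTn ⟨h, hlt⟩
  · exact absurd (hc _ h) (not_le.2 hlt)

theorem pendulum_nice (u w : ℝ → ℝ → ℝ → ℝ)
    (hu_cont : Continuous fun x : ℝ × ℝ × ℝ => u x.1 x.2.1 x.2.2)
    (hu_lip : ∀ K : Set (ℝ × ℝ × ℝ), IsCompact K → ∃ L : ℝ,
      ∀ a ∈ K, ∀ b ∈ K, a.2.2 = b.2.2 →
        |u a.1 a.2.1 a.2.2 - u b.1 b.2.1 b.2.2| ≤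
          L * dist ((a.1, a.2.1) : ℝ × ℝ) ((b.1, b.2.1) : ℝ × ℝ))
    (hw_cont : Continuous fun x : ℝ × ℝ × ℝ => w x.1 x.2.1 x.2.2)
    (hw_lip : ∀ K : Set (ℝ × ℝ × ℝ), IsCompact K → ∃ L : ℝ,
      ∀ a ∈ K, ∀ b ∈ K, a.2.2 = b.2.2 →
        |w a.1 a.2.1 a.2.2 - w b.1 b.2.1 b.2.2| ≤
          L * dist ((a.1, a.2.1) : ℝ × ℝ) ((b.1, b.2.1) : ℝ × ℝ)) :
    NiceField (fun t z => (z.2, u z.1 z.2 t * sin z.1 - cos z.1 + w z.1 z.2 t)) := by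
  constructor
  · have h1 : Continuous fun a : ℝ × ℝ × ℝ => u a.2.1 a.2.2 a.1 :=
      hu_cont.comp (by fun_prop : Continuous fun a : ℝ × ℝ × ℝ => (a.2.1, a.2.2, a.1))
    have h2 : Continuous fun a : ℝ × ℝ × ℝ => w a.2.1 a.2.2 a.1 :=
      hw_cont.comp (by fun_prop : Continuous fun a : ℝ × ℝ × ℝ => (a.2.1, a.2.2, a.1))
    fun_prop
  · intro R
    have hK := isCompact_closedBall (0 : ℝ × ℝ × ℝ) R
    obtain ⟨Lu, hLu⟩ := hu_lip _ hK
    obtain ⟨Lw, hLw⟩ := hw_lip _ hK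
    obtain ⟨C, hC⟩ := hK.exists_bound_of_continuousOn hu_cont.continuousOn
    refine ⟨(|C| + |Lu| + |Lw| + 1).toNNReal, fun t ht => ?_⟩
    apply LipschitzOnWith.of_dist_le_mul
    intro a ha b hb
    have mem : ∀ z ∈ Metric.closedBall (0 : ℝ × ℝ) R,
        (z.1, z.2, t) ∈ Metric.closedBall (0 : ℝ × ℝ × ℝ) R := by
      intro z hz
      simp only [Metric.mem_closedBall, Prod.dist_eq, Real.dist_eq, Prod.fst_zero,
        Prod.snd_zero, sub_zero, max_le_iff] at hz ⊢
      exact ⟨hz.1, hz.2, ht⟩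
    have e1 := hLu _ (mem a ha) _ (mem b hb) rfl
    have e2 := hLw _ (mem a ha) _ (mem b hb) rfl
    have e3 := hC _ (mem a ha)
    simp only [Prod.mk.eta] at e1 e2 e3
    rw [Real.norm_eq_abs] at e3
    rw [Real.coe_toNNReal _ (by positivity)]
    have hD : 0 ≤ dist a b := dist_nonneg
    have hfst : |a.1 - b.1| ≤ dist a b := by
      rw [Prod.dist_eq, Real.dist_eq]; exact le_max_left _ _
    have hsnd : |a.2 - b.2| ≤ dist a b := by
      rw [Prod.dist_eq, Real.dist_eq, Real.dist_eq]; exact le_max_right _ _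
    have hsin : |sin a.1 - sin b.1| ≤ dist a b := by
      have := Real.lipschitzWith_sin.dist_le_mul a.1 b.1
      simp only [Real.dist_eq, NNReal.coe_one, one_mul] at this
      linarith
    have hcos : |cos a.1 - cos b.1| ≤ dist a b := by
      have := Real.lipschitzWith_cos.dist_le_mul a.1 b.1
      simp only [Real.dist_eq, NNReal.coe_one, one_mul] at this
      linarith
    have e1' : |u a.1 a.2 t - u b.1 b.2 t| ≤ |Lu| * dist a b :=
      e1.trans (mul_le_mul_of_nonneg_right (le_abs_self _) hD)
    have e2' : |w a.1 a.2 t - w b.1 b.2 t| ≤ |Lw| * dist a b :=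
      e2.trans (mul_le_mul_of_nonneg_right (le_abs_self _) hD)
    have e3' : |u a.1 a.2 t| ≤ |C| := e3.trans (le_abs_self _)
    rw [Prod.dist_eq (x := (a.2, _))]
    apply max_le
    · simp only [Real.dist_eq]
      nlinarith [mul_nonneg (abs_nonneg C) hD, mul_nonneg (abs_nonneg Lu) hD,
        mul_nonneg (abs_nonneg Lw) hD]
    · simp only [Real.dist_eq]
      have split : u a.1 a.2 t * sin a.1 - cos a.1 + w a.1 a.2 t -
          (u b.1 b.2 t * sin b.1 - cos b.1 + w b.1 b.2 t) =
          u a.1 a.2 t * (sin a.1 - sin b.1) + (u a.1 a.2 t - u b.1 b.2 t) * sin b.1 +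
          (-(cos a.1 - cos b.1)) + (w a.1 a.2 t - w b.1 b.2 t) := by ring
      rw [split]
      have m1 : |u a.1 a.2 t * (sin a.1 - sin b.1)| ≤ |C| * dist a b := by
        rw [abs_mul]; exact mul_le_mul e3' hsin (abs_nonneg _) (abs_nonneg _)
      have m2 : |(u a.1 a.2 t - u b.1 b.2 t) * sin b.1| ≤ |Lu| * dist a b := by
        rw [abs_mul]
        exact (mul_le_of_le_one_right (abs_nonneg _) (abs_sin_le_one _)).trans e1'
      have m3 : |(-(cos a.1 - cos b.1))| ≤ dist a b := by rwa [abs_neg]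
      refine (abs_add_le _ _).trans ?_
      refine (add_le_add (abs_add_le _ _) le_rfl).trans ?_
      refine (add_le_add (add_le_add (abs_add_le _ _) le_rfl) le_rfl).trans ?_
      linarith

/-- For the controlled inverted pendulum with additional torque control,
`q̇ = p, ṗ = u(q,p,t)·sin q − cos q + w(q,p,t)`, where `u, w` are continuous and locally
Lipschitz in `(q,p)` with `w(0,0,t) < 1` and `w(π,0,t) > −1` for all `t`, if `μ = (q*, 0)`
with `0 < q* < π` is an equilibrium admitting a Lyapunov function satisfying L1 and L2 on a
closed set `U ⊆ M` with `μ` in its interior, then global stabilization is impossible: some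
solution stays in `M \ B` for all `t ≥ t₀`. -/
theorem inverted_pendulum_torque_no_global_stabilization
    (u w : ℝ → ℝ → ℝ → ℝ)
    (hu_cont : Continuous fun x : ℝ × ℝ × ℝ => u x.1 x.2.1 x.2.2)
    (hu_lip : ∀ K : Set (ℝ × ℝ × ℝ), IsCompact K → ∃ L : ℝ,
      ∀ a ∈ K, ∀ b ∈ K, a.2.2 = b.2.2 →
        |u a.1 a.2.1 a.2.2 - u b.1 b.2.1 b.2.2| ≤
          L * dist ((a.1, a.2.1) : ℝ × ℝ) ((b.1, b.2.1) : ℝ × ℝ))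
    (hw_cont : Continuous fun x : ℝ × ℝ × ℝ => w x.1 x.2.1 x.2.2)
    (hw_lip : ∀ K : Set (ℝ × ℝ × ℝ), IsCompact K → ∃ L : ℝ,
      ∀ a ∈ K, ∀ b ∈ K, a.2.2 = b.2.2 →
        |w a.1 a.2.1 a.2.2 - w b.1 b.2.1 b.2.2| ≤
          L * dist ((a.1, a.2.1) : ℝ × ℝ) ((b.1, b.2.1) : ℝ × ℝ))
    (hw0 : ∀ t : ℝ, w 0 0 t < 1)
    (hwπ : ∀ t : ℝ, w π 0 t > -1)
    (qstar : ℝ) (hq1 : 0 < qstar) (hq2 : qstar < π)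
    (hequil : ∀ t : ℝ, u qstar 0 t * sin qstar - cos qstar + w qstar 0 t = 0)
    (t₀ : ℝ)
    (U : Set (ℝ × ℝ)) (hUclosed : IsClosed U)
    (hUM : U ⊆ {z : ℝ × ℝ | 0 < z.1 ∧ z.1 < π})
    (hμint : (qstar, (0 : ℝ)) ∈ interior U)
    (V : ℝ × ℝ → ℝ) (DV : ℝ × ℝ → (ℝ × ℝ) →L[ℝ] ℝ)
    (hVdiff : ∀ z ∈ U, HasFDerivAt V (DV z) z)
    (hDVcont : ContinuousOn DV U)
    (hL1a : V (qstar, 0) = 0)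
    (hL1b : ∀ z ∈ U, z ≠ (qstar, (0 : ℝ)) → 0 < V z)
    (hL2 : ∀ t : ℝ, ∀ z ∈ U, z ≠ (qstar, (0 : ℝ)) →
      DV z (z.2, u z.1 z.2 t * sin z.1 - cos z.1 + w z.1 z.2 t) < 0) :
    ∃ (q₀ p₀ : ℝ) (B : Set (ℝ × ℝ)),
      0 < q₀ ∧ q₀ < π ∧
      IsOpen B ∧ (qstar, (0 : ℝ)) ∈ B ∧
      B ⊆ {z : ℝ × ℝ | 0 < z.1 ∧ z.1 < π} ∧
      ∀ I : Set ℝ, t₀ ∈ I → I.OrdConnected →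
        ∀ q p : ℝ → ℝ,
          (∀ t ∈ I, HasDerivWithinAt q (p t) I t) →
          (∀ t ∈ I, HasDerivWithinAt p
            (u (q t) (p t) t * sin (q t) - cos (q t) + w (q t) (p t) t) I t) →
          q t₀ = q₀ → p t₀ = p₀ →
          ∀ t ∈ I, t₀ ≤ t →
            (0 < q t ∧ q t < π) ∧ (q t, p t) ∉ B := by
  set F : ℝ → ℝ × ℝ → ℝ × ℝ :=
    fun t z => (z.2, u z.1 z.2 t * sin z.1 - cos z.1 + w z.1 z.2 t) with hFdef
  have hF : NiceField F := pendulum_nice u w hu_cont hu_lip hw_cont hw_lip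
  set m : ℝ × ℝ := (qstar, 0) with hm
  -- the trapping neighbourhood
  obtain ⟨r, hr, hrU⟩ := Metric.nhds_basis_closedBall.mem_iff.1 (mem_interior_iff_mem_nhds.1 hμint)
  have hVr : ∀ z ∈ Metric.closedBall m r, HasFDerivAt V (DV z) z := fun z hz => hVdiff z (hrU hz)
  have hVc : ContinuousOn V (Metric.closedBall m r) :=
    fun z hz => (hVr z hz).continuousAt.continuousWithinAt
  obtain ⟨c, hc0, hc⟩ : ∃ c > 0, ∀ z ∈ Metric.sphere m r, c ≤ V z := by
    have hne : (Metric.sphere m r).Nonempty := NormedSpace.sphere_nonempty.2 hr.le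
    obtain ⟨z, hz, hmin⟩ := (isCompact_sphere m r).exists_isMinOn hne
      (hVc.mono Metric.sphere_subset_closedBall)
    exact ⟨V z, hL1b z (hrU (Metric.sphere_subset_closedBall hz)) (Metric.ne_of_mem_sphere hz hr.ne'),
      fun y hy => hmin hy⟩
  set B : Set (ℝ × ℝ) := Metric.ball m r ∩ {z | V z < c} with hB
  have hBo : IsOpen B :=
    (hVc.mono Metric.ball_subset_closedBall).isOpen_inter_preimage Metric.isOpen_ball isOpen_Iio
  have hmB : m ∈ B := ⟨Metric.mem_ball_self hr, by
    show V m < c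
    rw [hL1a]; exact hc0⟩
  have hBM : B ⊆ {z : ℝ × ℝ | 0 < z.1 ∧ z.1 < π} :=
    fun z hz => hUM (hrU (Metric.ball_subset_closedBall hz.1))
  have hneg : ∀ t, ∀ z ∈ Metric.closedBall m r, DV z (F t z) ≤ 0 := by
    intro t z hz
    by_cases h : z = m
    · have : F t z = 0 := by
        rw [h]
        simp only [hFdef, hm]
        rw [hequil t]
        rfl
      rw [this, map_zero]
    · exact (hL2 t z (hrU hz) h).le
  have htrap : ∀ (x : ℝ → ℝ × ℝ) (T T' : ℝ), t₀ ≤ T → T ≤ T' →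
      IsIntegralCurveOn x F (Icc t₀ T') → x T ∈ B → x T' ∈ B := fun x T T' h1 h2 hx hxT =>
    trap hVr hneg hc hBo h2 (hx.mono (Icc_subset_Icc_left h1)) hxT
  -- the exit sets
  set OL : Set (ℝ × ℝ) := {z | 1 * (z.1 - 0) < 0} with hOL
  set OR : Set (ℝ × ℝ) := {z | (-1) * (z.1 - π) < 0} with hOR
  set PL : Set (ℝ × ℝ) := {z | z.1 < π} with hPL
  set PR : Set (ℝ × ℝ) := {z | 0 < z.1} with hPR
  have oOL : IsOpen OL := isOpen_lt (by fun_prop) (by fun_prop)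
  have oOR : IsOpen OR := isOpen_lt (by fun_prop) (by fun_prop)
  have oPL : IsOpen PL := isOpen_lt (by fun_prop) (by fun_prop)
  have oPR : IsOpen PR := isOpen_lt (by fun_prop) (by fun_prop)
  have dLR : ∀ z, z ∈ Reach F t₀ OL PL → z ∈ Reach F t₀ OR PR → False := by
    apply hF.disjoint_reach
    · intro x T T' _ _ _ h1 _ h2
      simp only [hOL, hPR, mem_ofPred_eq] at h1 h2; linarith
    · intro x T T' _ _ _ h1 _ h2
      simp only [hOR, hPL, mem_ofPred_eq] at h1 h2; linarith
  have dLB : ∀ z, z ∈ Reach F t₀ OL PL → z ∈ Reach F t₀ B (PR ∩ PL) → False := by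
    apply hF.disjoint_reach
    · intro x T T' _ _ _ h1 _ h2
      have h3 := h2.1
      simp only [hOL, hPR, mem_ofPred_eq] at h1 h3; linarith
    · intro x T T' ha hT hx h1 h2 _
      have h3 := (hBM (htrap x T T' ha hT hx h1)).1
      simp only [hOL, mem_ofPred_eq] at h2; linarith
  by_contra hcon
  push Not at hcon
  -- every point of the segment is in one of the three sets
  have cover : ∀ z : ℝ × ℝ, 0 < z.1 → z.1 < π →
      z ∈ Reach F t₀ OL PL ∨ z ∈ Reach F t₀ OR PR ∪ Reach F t₀ B (PR ∩ PL) := by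
    intro z hz0 hzπ
    obtain ⟨I, hI0, hI, q, p, hq, hp, hq0, hp0, t, htI, ht, hbad⟩ :=
      hcon z.1 z.2 B hz0 hzπ hBo hmB hBM
    have hsub : Icc t₀ t ⊆ I := hI.out hI0 htI
    set x : ℝ → ℝ × ℝ := fun s => (q s, p s) with hxdef
    have hx : IsIntegralCurveOn x F (Icc t₀ t) := fun s hs =>
      ((hq s (hsub hs)).mono hsub).prodMk ((hp s (hsub hs)).mono hsub)
    have hx0 : x t₀ = z := Prod.ext hq0 hp0
    by_cases hall : ∀ s ∈ Icc t₀ t, x s ∈ PR ∩ PL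
    · right; right
      have h1 := hall t ⟨ht, le_rfl⟩
      exact ⟨t, ht, x, hx0, hx, hbad ⟨h1.1, h1.2⟩, hall⟩
    · push Not at hall
      obtain ⟨s, hs, hsn⟩ := hall
      have hxs := hx.mono (Icc_subset_Icc_right hs.2)
      obtain ⟨T, hT, hTn, hTI⟩ := first_time (HasDerivWithinAt.continuousOn hxs) hs.1
        (oPR.inter oPL) hsn
      have hzT : t₀ < T := lt_of_le_of_ne hT.1 (fun h => hTn (by rw [← h, hx0]; exact ⟨hz0, hzπ⟩))
      have hxT := hxs.mono (Icc_subset_Icc_right hT.2)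
      have hTm : T ∈ Icc t₀ T := ⟨hzT.le, le_rfl⟩
      have hcl : x T ∈ {z : ℝ × ℝ | 0 ≤ z.1 ∧ z.1 ≤ π} := by
        have hcl' : IsClosed {z : ℝ × ℝ | 0 ≤ z.1 ∧ z.1 ≤ π} :=
          isClosed_Icc.preimage (continuous_fst : Continuous (Prod.fst : ℝ × ℝ → ℝ))
        have hcw : ContinuousWithinAt x (Ico t₀ T) T :=
          ((HasDerivWithinAt.continuousOn hxT) T hTm).mono Ico_subset_Icc_self
        have := hcw.mem_closure (t := {z : ℝ × ℝ | 0 ≤ z.1 ∧ z.1 ≤ π})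
          (by rw [closure_Ico hzT.ne]; exact hTm)
          (fun s hs => ⟨(hTI s hs).1.le, (hTI s hs).2.le⟩)
        rwa [hcl'.closure_eq] at this
      have hdq : ∀ s ∈ Icc t₀ T, HasDerivWithinAt q (p s) (Icc t₀ T) s :=
        fun s hs => curve_fst (hxT s hs)
      have hdp : HasDerivWithinAt p
          (u (q T) (p T) T * sin (q T) - cos (q T) + w (q T) (p T) T) (Icc t₀ T) T :=
        curve_snd (hxT T hTm)
      have hor : q T = 0 ∨ q T = π := by
        by_contra hno
        push Not at hno
        exact hTn ⟨lt_of_le_of_ne hcl.1 (Ne.symm hno.1), lt_of_le_of_ne hcl.2 hno.2⟩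
      rcases hor with h0 | hπ
      · left
        have hpneg : p T < 0 := by
          refine boundary_sign hzT hdq hdp (fun s hs => (hTI s hs).1) h0 (fun hp0 => ?_)
          rw [h0, hp0, sin_zero, cos_zero]
          linarith [hw0 T]
        rw [← hx0]
        refine hF.leaves hzT.le oPL hxT (fun s hs => ?_) ?_ ?_
        · rcases lt_or_eq_of_le hs.2 with h | h
          · exact (hTI s ⟨hs.1, h⟩).2
          · rw [h]
            show q T < π
            rw [h0]; exact pi_pos
        · show 1 * (q T - 0) = 0
          rw [h0]; ring
        · show 1 * p T < 0
          linarith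
      · right; left
        have hppos : -p T < 0 := by
          refine boundary_sign (q := fun s => π - q s) (p := fun s => -p s) hzT
            (fun s hs => (hdq s hs).const_sub π) hdp.neg
            (fun s hs => sub_pos.2 (hTI s hs).2) (by simp [hπ]) (fun hp0 => ?_)
          have hp0' : p T = 0 := neg_eq_zero.1 hp0
          rw [hπ, hp0', sin_pi, cos_pi]
          linarith [hwπ T]
        rw [← hx0]
        refine hF.leaves hzT.le oPR hxT (fun s hs => ?_) ?_ ?_
        · rcases lt_or_eq_of_le hs.2 with h | h
          · exact (hTI s ⟨hs.1, h⟩).1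
          · rw [h]
            show 0 < q T
            rw [hπ]; exact pi_pos
        · show (-1) * (q T - π) = 0
          rw [hπ]; ring
        · show (-1) * p T < 0
          linarith
  have trivial_curve : ∀ z : ℝ × ℝ, IsIntegralCurveOn (fun _ => z) F (Icc t₀ t₀) := by
    intro z s hs
    rw [Icc_self] at hs ⊢
    rw [mem_singleton_iff.1 hs]
    exact HasFDerivWithinAt.singleton
  have hstart : ((0, -1) : ℝ × ℝ) ∈ Reach F t₀ OL PL := by
    have := hF.leaves le_rfl oPL (trivial_curve (0, -1)) (fun _ _ => (pi_pos : (0 : ℝ) < π))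
      (s := 1) (k := 0) (by simp) (by simp [hFdef])
    exact this
  have hend : m ∈ Reach F t₀ B (PR ∩ PL) :=
    ⟨t₀, le_rfl, fun _ => m, rfl, trivial_curve m, hmB, fun _ _ => ⟨hq1, hq2⟩⟩
  have hconn : IsPreconnected ((fun s : ℝ => ((s * qstar, s - 1) : ℝ × ℝ)) '' Icc 0 1) :=
    isPreconnected_Icc.image _ (by fun_prop)
  have hopen2 : IsOpen (Reach F t₀ OR PR ∪ Reach F t₀ B (PR ∩ PL)) :=
    (hF.isOpen_reach t₀ oOR oPR).union (hF.isOpen_reach t₀ hBo (oPR.inter oPL))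
  obtain ⟨z, -, hz1, hz2⟩ := hconn _ _ (hF.isOpen_reach t₀ oOL oPL) hopen2 (by
      rintro _ ⟨s, hs, rfl⟩
      rcases eq_or_lt_of_le hs.1 with h | h
      · left
        simpa [← h] using hstart
      · exact cover _ (mul_pos h hq1) (by
          show s * qstar < π
          nlinarith [hs.2]))
    ⟨(0, -1), ⟨0, by simp, by simp⟩, hstart⟩
    ⟨m, ⟨1, by simp, by simp [hm]⟩, Or.inr hend⟩
  rcases hz2 with hz2 | hz2
  · exact dLR z hz1 hz2
  · exact dLB z hz1 hz2
end

section
/- Consider the pendulum-on-a-cart system with cart mass m > 0 and control force u : ℝ⁵ → ℝ (a function of (q, p, x, y, t)) continuous in all variables and locally Lipschitz in the state variables. Let μ ∈ M = {(q,p,x,y) : 0 < q < π} be an equilibrium of the system, and let t₀ ∈ ℝ. Suppose there exists a Lyapunov function V satisfying conditions L1 and L2 on a closed set U ⊆ M containing μ in its interior. Then there exist an initial condition (q₀, p₀, x₀, y₀) with 0 < q₀ < π and an open neighborhood B ⊆ M of μ such that every solution with this initial condition at time t₀ satisfies 0 < q(t) < π and (q(t), p(t), x(t), y(t)) ∉ B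 for all t ≥ t₀ in its interval of existence. -/
open Real Set

/-- The `ṗ` component of the pendulum-on-a-cart vector field; state `z = (q, p, x, y)`. -/
noncomputable def cartPAcc (m : ℝ) (u : ℝ → ℝ → ℝ → ℝ → ℝ → ℝ)
    (z : ℝ × ℝ × ℝ × ℝ) (t : ℝ) : ℝ :=
  (u z.1 z.2.1 z.2.2.1 z.2.2.2 t * Real.sin z.1
    + z.2.1 ^ 2 * Real.sin z.1 * Real.cos z.1
    - (1 + m) * Real.cos z.1) / (m + (Real.cos z.1) ^ 2)

/-- The `ẏ` component of the pendulum-on-a-cart vector field; state `z = (q, p, x, y)`. -/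
noncomputable def cartYAcc (m : ℝ) (u : ℝ → ℝ → ℝ → ℝ → ℝ → ℝ)
    (z : ℝ × ℝ × ℝ × ℝ) (t : ℝ) : ℝ :=
  (u z.1 z.2.1 z.2.2.1 z.2.2.2 t
    + z.2.1 ^ 2 * Real.cos z.1
    - Real.sin z.1 * Real.cos z.1) / (m + (Real.cos z.1) ^ 2)

/-- The state space. -/
abbrev CartE := ℝ × ℝ × ℝ × ℝ

/-- Solutions on `[a, b]`. -/
def CartSol (f : ℝ → CartE → CartE) (a b : ℝ) (z : ℝ → CartE) : Prop :=
  ∀ t ∈ Icc a b, HasDerivWithinAt z (f t (z t)) (Icc a b) t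

/-- Clamp a real number to `[-R, R]`. -/
noncomputable def clamp1 (R r : ℝ) : ℝ := max (-R) (min R r)

lemma clamp1_lip (R : ℝ) : LipschitzWith 1 (clamp1 R) :=
  (LipschitzWith.id.const_min R).const_max (-R)

lemma clamp1_eq {R r : ℝ} (h : |r| ≤ R) : clamp1 R r = r := by
  rw [abs_le] at h
  simp [clamp1, min_eq_right h.2, max_eq_right h.1]

lemma clamp1_abs {R : ℝ} (hR : 0 ≤ R) (r : ℝ) : |clamp1 R r| ≤ R := by
  rw [abs_le]
  exact ⟨le_max_left _ _, max_le (by linarith) (min_le_left _ _)⟩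

/-- Clamp a state to the box. -/
noncomputable def clamp4 (R : ℝ) (z : CartE) : CartE :=
  (clamp1 R z.1, clamp1 R z.2.1, clamp1 R z.2.2.1, clamp1 R z.2.2.2)

lemma clamp4_lip (R : ℝ) : LipschitzWith 1 (clamp4 R) := by
  have h := clamp1_lip R
  have h1 : LipschitzWith 1 (fun z : CartE => z.1) := LipschitzWith.prod_fst
  have h2 : LipschitzWith 1 (fun z : CartE => z.2) := LipschitzWith.prod_snd
  have h3 : LipschitzWith 1 (fun z : CartE => z.2.1) := by
    have := (LipschitzWith.prod_fst (α := ℝ) (β := ℝ × ℝ)).comp h2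
    rwa [one_mul] at this
  have h4 : LipschitzWith 1 (fun z : CartE => z.2.2) := by
    have := (LipschitzWith.prod_snd (α := ℝ) (β := ℝ × ℝ)).comp h2
    rwa [one_mul] at this
  have h5 : LipschitzWith 1 (fun z : CartE => z.2.2.1) := by
    have := (LipschitzWith.prod_fst (α := ℝ) (β := ℝ)).comp h4
    rwa [one_mul] at this
  have h6 : LipschitzWith 1 (fun z : CartE => z.2.2.2) := by
    have := (LipschitzWith.prod_snd (α := ℝ) (β := ℝ)).comp h4
    rwa [one_mul] at this
  have := (h.comp h1).prodMk ((h.comp h3).prodMk ((h.comp h5).prodMk (h.comp h6)))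
  simp only [one_mul, max_self] at this
  exact this

lemma clamp4_eq {R : ℝ} {z : CartE} (h : ‖z‖ ≤ R) : clamp4 R z = z := by
  simp only [Prod.norm_def, Real.norm_eq_abs, max_le_iff] at h
  obtain ⟨h1, h2, h3, h4⟩ := h
  simp [clamp4, clamp1_eq, *]

lemma clamp4_norm {R : ℝ} (hR : 0 ≤ R) (z : CartE) : ‖clamp4 R z‖ ≤ R := by
  simp only [Prod.norm_def, Real.norm_eq_abs, max_le_iff, clamp4]
  exact ⟨clamp1_abs hR _, clamp1_abs hR _, clamp1_abs hR _, clamp1_abs hR _⟩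

lemma CartSol.cont {f : ℝ → CartE → CartE} {a b : ℝ} {z : ℝ → CartE} (h : CartSol f a b z) :
    ContinuousOn z (Icc a b) := fun t ht => (h t ht).continuousWithinAt

lemma CartSol.mono {f : ℝ → CartE → CartE} {a b c : ℝ} {z : ℝ → CartE} (h : CartSol f a b z)
    (hc : c ≤ b) : CartSol f a c z := fun t ht =>
  (h t ⟨ht.1, ht.2.trans hc⟩).mono (Icc_subset_Icc le_rfl hc)

lemma CartSol.gronwall {f : ℝ → CartE → CartE} {a b : ℝ} {z w : ℝ → CartE}
    (hz : CartSol f a b z) (hw : CartSol f a b w) {K : NNReal} {s : Set CartE}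
    (hK : ∀ t ∈ Icc a b, LipschitzOnWith K (f t) s)
    (hzs : ∀ t ∈ Icc a b, z t ∈ s) (hws : ∀ t ∈ Icc a b, w t ∈ s) :
    ∀ t ∈ Icc a b, dist (z t) (w t) ≤ dist (z a) (w a) * Real.exp (K * (t - a)) := by
  have key : ∀ v : ℝ → CartE, CartSol f a b v → ∀ t ∈ Ico a b,
      HasDerivWithinAt v (f t (v t)) (Ici t) t := by
    intro v hv t ht
    refine (hv t ⟨ht.1, ht.2.le⟩).mono_of_mem_nhdsWithin ?_
    exact Filter.mem_of_superset (Icc_mem_nhdsGE ht.2) (Icc_subset_Icc ht.1 le_rfl)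
  exact dist_le_of_trajectories_ODE_of_mem (s := fun _ => s)
    (fun t ht => hK t ⟨ht.1, ht.2.le⟩) hz.cont (key z hz)
    (fun t ht => hzs t ⟨ht.1, ht.2.le⟩) hw.cont (key w hw)
    (fun t ht => hws t ⟨ht.1, ht.2.le⟩) le_rfl

lemma CartSol.bdd {f : ℝ → CartE → CartE} {a b : ℝ} {z : ℝ → CartE} (h : CartSol f a b z) :
    ∃ R : ℝ, 0 ≤ R ∧ ∀ t ∈ Icc a b, ‖z t‖ ≤ R := by
  obtain ⟨R, hR⟩ := isCompact_Icc.exists_bound_of_continuousOn h.cont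
  exact ⟨max R 0, le_max_right _ _, fun t ht => (hR t ht).trans (le_max_left _ _)⟩

/-- Locally Lipschitz vector field. -/
def CartLip (f : ℝ → CartE → CartE) : Prop :=
  ∀ a b R : ℝ, ∃ K : NNReal, ∀ t ∈ Icc a b, LipschitzOnWith K (f t) (Metric.closedBall 0 R)

lemma CartSol.unique {f : ℝ → CartE → CartE} (hf : CartLip f) {a b : ℝ} {z w : ℝ → CartE}
    (hz : CartSol f a b z) (hw : CartSol f a b w) (h0 : z a = w a) :
    ∀ t ∈ Icc a b, z t = w t := by
  obtain ⟨R, _, hR⟩ := hz.bdd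
  obtain ⟨Ralt, _, hR'⟩ := hw.bdd
  obtain ⟨K, hK⟩ := hf a b (max R Ralt)
  intro t ht
  have := hz.gronwall hw hK
    (fun t ht => by simpa using Or.inl (hR t ht)) (fun t ht => by simpa using Or.inr (hR' t ht)) t ht
  rw [h0, dist_self, zero_mul] at this
  exact dist_le_zero.1 this

lemma cart_flow_box {f : ℝ → CartE → CartE} (hfc : Continuous (Function.uncurry f))
    (hf : CartLip f) {a b : ℝ} (hab : a ≤ b) {z : ℝ → CartE} (hz : CartSol f a b z) :
    ∃ ε > 0, ∃ C > 0, ∃ w : CartE → ℝ → CartE, (∀ t ∈ Icc a b, w (z a) t = z t) ∧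
      ∀ ξ ∈ Metric.ball (z a) ε, w ξ a = ξ ∧ CartSol f a (b + ε) (w ξ) ∧
        ∀ t ∈ Icc a (b + ε), dist (w ξ t) (w (z a) t) ≤ C * dist ξ (z a) := by
  obtain ⟨R, hR0, hR⟩ := hz.bdd
  obtain ⟨K, hK⟩ := hf a (b + 1) (R + 2)
  obtain ⟨L, hL⟩ := (isCompact_Icc (a := a) (b := b + 1)).prod
    (isCompact_closedBall (0 : CartE) (R + 2)) |>.exists_bound_of_continuousOn hfc.continuousOn
  have hR2 : 0 ≤ R + 2 := by linarith
  set g : ℝ → CartE → CartE := fun t x => f t (clamp4 (R + 2) x) with hg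
  have hcm : ∀ x, clamp4 (R + 2) x ∈ Metric.closedBall (0 : CartE) (R + 2) := fun x => by
    simpa using clamp4_norm hR2 x
  have gK : ∀ t ∈ Icc a (b + 1), LipschitzOnWith K (g t) univ := by
    intro t ht
    have := (hK t ht).comp ((clamp4_lip (R + 2)).lipschitzOnWith (s := univ)) (fun x _ => hcm x)
    rwa [mul_one] at this
  have gL : ∀ t ∈ Icc a (b + 1), ∀ x, ‖g t x‖ ≤ (Real.toNNReal L : ℝ) := by
    intro t ht x
    exact (hL (t, clamp4 (R + 2) x) ⟨ht, hcm x⟩).trans (Real.le_coe_toNNReal L)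
  have ex : ∀ ξ : CartE, ∃ w : ℝ → CartE, w a = ξ ∧ CartSol g a (b + 1) w := by
    intro ξ
    have P : IsPicardLindelof g (⟨a, by constructor <;> linarith⟩ : Icc a (b + 1)) ξ
        (Real.toNNReal L * Real.toNNReal (b + 1 - a)) 0 (Real.toNNReal L) K := by
      refine ⟨fun t ht => (gK t ht).mono (subset_univ _), fun x _ => ?_,
        fun t ht x _ => gL t ht x, ?_⟩
      · exact (hfc.comp (by fun_prop : Continuous fun t : ℝ => (t, clamp4 (R + 2) x))).continuousOn
      · have : 0 ≤ b + 1 - a := by linarith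
        simp [this]
    obtain ⟨w, h1, h2⟩ := P.exists_eq_forall_mem_Icc_hasDerivWithinAt₀
    exact ⟨w, h1, h2⟩
  choose w w0 ws using ex
  have hzg : CartSol g a b z := by
    intro t ht
    have := hz t ht
    simp only [hg]
    rwa [clamp4_eq (by linarith [hR t ht])]
  have weq : ∀ t ∈ Icc a b, w (z a) t = z t := by
    intro t ht
    have := ((ws (z a)).mono (by linarith : b ≤ b + 1)).gronwall hzg
      (fun t ht => gK t ⟨ht.1, by linarith [ht.2]⟩) (by simp) (by simp) t ht
    rw [w0, dist_self, zero_mul] at this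
    exact dist_le_zero.1 this
  set C := Real.exp (K * (b + 1 - a)) with hC
  have hC0 : 0 < C := Real.exp_pos _
  have wd : ∀ ξ, ∀ t ∈ Icc a (b + 1), dist (w ξ t) (w (z a) t) ≤ C * dist ξ (z a) := by
    intro ξ t ht
    have := (ws ξ).gronwall (ws (z a)) gK (by simp) (by simp) t ht
    rw [w0, w0] at this
    rw [mul_comm]
    refine this.trans ?_
    have : Real.exp (K * (t - a)) ≤ C := by
      rw [hC]
      gcongr
      exact ht.2
    gcongr
  -- continuity past b
  have hbm : b ∈ Icc a (b + 1) := ⟨hab, by linarith⟩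
  have hcb := (ws (z a)).cont b hbm
  obtain ⟨δ, hδ, hδb⟩ := Metric.continuousWithinAt_iff.1 hcb 1 one_pos
  set ε := min (min (δ / 2) 1) (1 / C) with hε
  have hε0 : 0 < ε := by positivity
  have e1 : ε ≤ δ / 2 := (min_le_left _ _).trans (min_le_left _ _)
  have e2 : ε ≤ 1 := (min_le_left _ _).trans (min_le_right _ _)
  have e3 : ε ≤ 1 / C := min_le_right _ _
  have wb : ∀ t ∈ Icc a (b + ε), ‖w (z a) t‖ ≤ R + 1 := by
    intro t ht
    rcases le_total t b with h | h
    · rw [weq t ⟨ht.1, h⟩]; linarith [hR t ⟨ht.1, h⟩]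
    · have h1 := hδb (x := t) ⟨ht.1, by linarith [ht.2]⟩ (by
        rw [Real.dist_eq, abs_of_nonneg (by linarith)]; linarith [ht.2])
      rw [weq b ⟨hab, le_rfl⟩, dist_eq_norm] at h1
      have h2 := hR b ⟨hab, le_rfl⟩
      have h3 := norm_add_le (w (z a) t - z b) (z b)
      rw [sub_add_cancel] at h3
      linarith
  refine ⟨ε, hε0, C, hC0, w, weq, fun ξ hξ => ⟨w0 ξ, ?_, fun t ht => wd ξ t ⟨ht.1, by linarith [ht.2]⟩⟩⟩
  intro t ht
  have h1 := wd ξ t ⟨ht.1, by linarith [ht.2]⟩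
  have h2 : C * dist ξ (z a) ≤ 1 := by
    have : dist ξ (z a) ≤ 1 / C := (Metric.mem_ball.1 hξ).le.trans e3
    rw [le_div_iff₀ hC0] at this
    linarith
  rw [dist_eq_norm] at h1
  have h3 := norm_add_le (w ξ t - w (z a) t) (w (z a) t)
  rw [sub_add_cancel] at h3
  have h4 := ((ws ξ).mono (by linarith : b + ε ≤ b + 1)) t ht
  simp only [hg] at h4
  rwa [clamp4_eq (by linarith [wb t ht])] at h4

/-- Initial points whose solution stays in `G` up to a time at which it lies in `W`. -/
def cartReach (f : ℝ → CartE → CartE) (a : ℝ) (G W : Set CartE) : Set CartE :=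
  {ξ | ∃ b z, a ≤ b ∧ CartSol f a b z ∧ z a = ξ ∧ (∀ t ∈ Icc a b, z t ∈ G) ∧ z b ∈ W}

lemma cartReach_open {f : ℝ → CartE → CartE} (hfc : Continuous (Function.uncurry f))
    (hf : CartLip f) (a : ℝ) {G W : Set CartE} (hG : IsOpen G) (hW : IsOpen W) :
    IsOpen (cartReach f a G W) := by
  rw [Metric.isOpen_iff]
  rintro ξ ⟨b, z, hab, hz, rfl, hzG, hzW⟩
  obtain ⟨ε, hε, C, hC, w, hw, H⟩ := cart_flow_box hfc hf hab hz
  obtain ⟨δ, hδ, hδG⟩ := (isCompact_Icc.image_of_continuousOn hz.cont).exists_thickening_subset_open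
    hG (by rintro _ ⟨t, ht, rfl⟩; exact hzG t ht)
  obtain ⟨η, hη, hηW⟩ := Metric.isOpen_iff.1 hW _ hzW
  refine ⟨min ε (min (δ / C) (η / C)), by positivity, fun ξ hξ => ?_⟩
  simp only [Metric.mem_ball, lt_min_iff, lt_div_iff₀ hC] at hξ
  obtain ⟨h1, h2, h3⟩ := hξ
  obtain ⟨w0, ws, wd⟩ := H ξ h1
  have hbε : b ≤ b + ε := by linarith
  refine ⟨b, w ξ, hab, ws.mono hbε, w0, fun t ht => hδG ?_, hηW ?_⟩
  · have := wd t ⟨ht.1, ht.2.trans hbε⟩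
    rw [hw t ht] at this
    exact Metric.mem_thickening_iff.2 ⟨z t, ⟨t, ht, rfl⟩, by linarith⟩
  · have := wd b ⟨hab, hbε⟩
    rw [hw b ⟨hab, le_rfl⟩] at this
    rw [Metric.mem_ball]; linarith

lemma cart_cross {g h k : ℝ → ℝ} {a b c : ℝ} (hab : a ≤ b) (hbc : b < c)
    (hg : ∀ t ∈ Icc a c, HasDerivWithinAt g (h t) (Icc a c) t)
    (hh : ∀ t ∈ Icc a c, HasDerivWithinAt h (k t) (Icc a c) t)
    (hgb : g b = 0) (hhb : h b ≤ 0) (hk : k b < 0) :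
    ∃ δ > 0, b + δ ≤ c ∧ ∀ t ∈ Ioc b (b + δ), g t < 0 := by
  have hbm : b ∈ Icc a c := ⟨hab, hbc.le⟩
  have hsub : Icc b c ⊆ Icc a c := Icc_subset_Icc hab le_rfl
  -- eventually `h < 0` to the right of `b`
  have hev : ∀ᶠ t in nhdsWithin b (Ioi b), h t < 0 := by
    have hd : HasDerivWithinAt h (k b) (Ioi b) b := by
      refine (hh b hbm).mono_of_mem_nhdsWithin ?_
      exact Filter.mem_of_superset (Ioc_mem_nhdsGT hbc)
        (fun t ht => ⟨hab.trans ht.1.le, ht.2⟩)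
    rw [hasDerivWithinAt_iff_tendsto_slope' (by simp)] at hd
    have h1 := hd.eventually (gt_mem_nhds hk)
    filter_upwards [h1, self_mem_nhdsWithin] with t ht htb
    have htb' : 0 < t - b := sub_pos.2 htb
    rw [slope_def_field, div_lt_iff₀ htb', zero_mul] at ht
    linarith
  obtain ⟨d, hd, hdn⟩ := (mem_nhdsGT_iff_exists_Ioc_subset).1 hev
  have hd' : b < d := hd
  have hm : b < min d c := lt_min hd' hbc
  refine ⟨min d c - b, by linarith, by linarith [min_le_right d c], fun t ht => ?_⟩
  have htd : t ≤ d := by linarith [ht.2, min_le_left d c]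
  have htc : t ≤ c := by linarith [ht.2, min_le_right d c]
  have hanti : StrictAntiOn g (Icc b t) := by
    refine strictAntiOn_of_hasDerivWithinAt_neg (f' := h) (convex_Icc _ _) ?_ ?_ ?_
    · intro s hs
      exact (hg s ⟨hab.trans hs.1, hs.2.trans htc⟩).continuousWithinAt.mono
        (Icc_subset_Icc hab htc)
    · intro s hs
      have hs' := interior_subset hs
      exact (hg s ⟨hab.trans hs'.1, hs'.2.trans htc⟩).mono
        (interior_subset.trans (Icc_subset_Icc hab htc))
    · intro s hs
      rw [interior_Icc] at hs
      exact hdn ⟨hs.1, hs.2.le.trans htd⟩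
  have := hanti (left_mem_Icc.2 ht.1.le) (right_mem_Icc.2 ht.1.le) ht.1
  linarith

lemma cart_left_deriv {g : ℝ → ℝ} {g' a b : ℝ} (hab : a < b)
    (hg : HasDerivWithinAt g g' (Icc a b) b) (hgb : g b = 0) (hpos : ∀ t ∈ Ico a b, 0 < g t) :
    g' ≤ 0 := by
  have hd : HasDerivWithinAt g g' (Iio b) b := by
    refine hg.mono_of_mem_nhdsWithin ?_
    exact Filter.mem_of_superset (Ico_mem_nhdsLT hab) Ico_subset_Icc_self
  rw [hasDerivWithinAt_iff_tendsto_slope' (by simp)] at hd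
  refine le_of_tendsto hd ?_
  filter_upwards [Ico_mem_nhdsLT hab] with t ht
  rw [slope_def_field, hgb]
  have h1 := hpos t ht
  have h2 : t - b < 0 := by linarith [ht.2]
  exact div_nonpos_of_nonneg_of_nonpos (by linarith) h2.le

lemma cart_V_anti {f : ℝ → CartE → CartE} {a b c d : ℝ} {z : ℝ → CartE} (hz : CartSol f a b z)
    (hac : a ≤ c) (hdb : d ≤ b) {U : Set CartE} {V : CartE → ℝ} {DV : CartE → CartE →L[ℝ] ℝ}
    (hV : ∀ x ∈ U, HasFDerivAt V (DV x) x) (hneg : ∀ t, ∀ x ∈ U, DV x (f t x) ≤ 0)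
    (hU : ∀ t ∈ Icc c d, z t ∈ U) : AntitoneOn (fun t => V (z t)) (Icc c d) := by
  have hsub : Icc c d ⊆ Icc a b := Icc_subset_Icc hac hdb
  have key : ∀ t ∈ Icc c d,
      HasDerivWithinAt (fun t => V (z t)) (DV (z t) (f t (z t))) (Icc c d) t := fun t ht =>
    (hV _ (hU t ht)).comp_hasDerivWithinAt t ((hz t (hsub ht)).mono hsub)
  exact antitoneOn_of_hasDerivWithinAt_nonpos (convex_Icc _ _)
    (fun t ht => (key t ht).continuousWithinAt)
    (fun t ht => (key t (interior_subset ht)).mono interior_subset)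
    (fun t ht => hneg t _ (hU t (interior_subset ht)))

lemma cart_inv {f : ℝ → CartE → CartE} {a b : ℝ} {z : ℝ → CartE} (hz : CartSol f a b z)
    {U : Set CartE} {V : CartE → ℝ} {DV : CartE → CartE →L[ℝ] ℝ}
    (hV : ∀ x ∈ U, HasFDerivAt V (DV x) x) (hneg : ∀ t, ∀ x ∈ U, DV x (f t x) ≤ 0)
    {μ : CartE} {r c : ℝ} (hball : Metric.closedBall μ r ⊆ U)
    (hc : ∀ x ∈ Metric.sphere μ r, c ≤ V x) {T : ℝ} (haT : a ≤ T) (hTb : T ≤ b)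
    (hT : z T ∈ Metric.ball μ r ∧ V (z T) < c) : z b ∈ Metric.ball μ r ∧ V (z b) < c := by
  have hcont : ContinuousOn (fun t => dist (z t) μ) (Icc T b) :=
    (continuous_id.dist continuous_const).comp_continuousOn
      (hz.cont.mono (Icc_subset_Icc haT le_rfl))
  have hin : ∀ t ∈ Icc T b, z t ∈ Metric.ball μ r := by
    by_contra hcon
    push Not at hcon
    set S := Icc T b ∩ (fun t => dist (z t) μ) ⁻¹' (Ici r) with hS
    have hSc : IsClosed S := hcont.preimage_isClosed_of_isClosed isClosed_Icc isClosed_Ici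
    have hSne : S.Nonempty := by
      obtain ⟨t, ht, h⟩ := hcon
      exact ⟨t, ht, by simpa using h⟩
    have hSb : BddBelow S := ⟨T, fun t ht => ht.1.1⟩
    have hm : sInf S ∈ S := hSc.csInf_mem hSne hSb
    set τ := sInf S with hτ
    have hbef : ∀ t ∈ Ico T τ, dist (z t) μ < r := by
      intro t ht
      by_contra hlt
      have : t ∈ S := ⟨⟨ht.1, ht.2.le.trans hm.1.2⟩, not_lt.1 hlt⟩
      exact absurd (csInf_le hSb this) (not_le.2 ht.2)
    have hTτ : T < τ := by
      refine lt_of_le_of_ne hm.1.1 (fun h => ?_)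
      have h1 := hm.2
      have h2 := hT.1
      rw [← h] at h1
      simp only [mem_preimage, mem_Ici] at h1
      rw [Metric.mem_ball] at h2
      linarith
    have hle : dist (z τ) μ ≤ r := by
      have h1 : ContinuousWithinAt (fun t => dist (z t) μ) (Ico T τ) τ :=
        (hcont τ hm.1).mono (fun t ht => ⟨ht.1, ht.2.le.trans hm.1.2⟩)
      have h2 : (nhdsWithin τ (Ico T τ)).NeBot := by
        rw [← mem_closure_iff_nhdsWithin_neBot, closure_Ico hTτ.ne]
        exact right_mem_Icc.2 hTτ.le
      refine le_of_tendsto h1.tendsto ?_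
      filter_upwards [self_mem_nhdsWithin] with t ht using (hbef t ht).le
    have hanti := cart_V_anti hz haT hm.1.2 hV hneg (c := T) (d := τ) (fun t ht => hball (by
      rcases eq_or_lt_of_le ht.2 with h | h
      · rw [h]; exact hle
      · exact (hbef t ⟨ht.1, h⟩).le))
    have h1 := hanti (left_mem_Icc.2 hTτ.le) (right_mem_Icc.2 hTτ.le) hTτ.le
    have h2 := hc (z τ) (le_antisymm hle hm.2)
    have h3 := hT.2
    simp only at h1
    linarith
  have hanti := cart_V_anti hz haT le_rfl hV hneg (c := T) (d := b)
    (fun t ht => hball (Metric.ball_subset_closedBall (hin t ht)))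
  have h1 := hanti (left_mem_Icc.2 hTb) (right_mem_Icc.2 hTb) hTb
  exact ⟨hin b (right_mem_Icc.2 hTb), lt_of_le_of_lt h1 hT.2⟩

/-- The vector field. -/
noncomputable def cartField (m : ℝ) (u : ℝ → ℝ → ℝ → ℝ → ℝ → ℝ) (t : ℝ) (z : CartE) : CartE :=
  (z.2.1, cartPAcc m u z t, z.2.2.2, cartYAcc m u z t)

/-- The vector field with the control as a variable. -/
noncomputable def cartAux (m : ℝ) (w : CartE × ℝ) : CartE :=
  (w.1.2.1, (w.2 * Real.sin w.1.1
    + w.1.2.1 ^ 2 * Real.sin w.1.1 * Real.cos w.1.1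
    - (1 + m) * Real.cos w.1.1) / (m + (Real.cos w.1.1) ^ 2), w.1.2.2.2,
    (w.2 + w.1.2.1 ^ 2 * Real.cos w.1.1
    - Real.sin w.1.1 * Real.cos w.1.1) / (m + (Real.cos w.1.1) ^ 2))

lemma cartAux_contDiff {m : ℝ} (hm : 0 < m) : ContDiff ℝ 1 (cartAux m) := by
  have h : ∀ w : CartE × ℝ, m + (Real.cos w.1.1) ^ 2 ≠ 0 := fun w => by positivity
  unfold cartAux
  refine ContDiff.prodMk (by fun_prop) (ContDiff.prodMk (ContDiff.div ?_ ?_ h)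
    (ContDiff.prodMk (by fun_prop) (ContDiff.div ?_ ?_ h))) <;> fun_prop

lemma cartField_cont {m : ℝ} (hm : 0 < m) {u : ℝ → ℝ → ℝ → ℝ → ℝ → ℝ}
    (hu_cont : Continuous fun x : ℝ × ℝ × ℝ × ℝ × ℝ =>
      u x.1 x.2.1 x.2.2.1 x.2.2.2.1 x.2.2.2.2) :
    Continuous (Function.uncurry (cartField m u)) := by
  have h1 : Continuous (fun w : ℝ × CartE =>
      (w.2, u w.2.1 w.2.2.1 w.2.2.2.1 w.2.2.2.2 w.1)) := by
    refine continuous_snd.prodMk ?_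
    exact hu_cont.comp (by fun_prop : Continuous (fun w : ℝ × CartE =>
      (w.2.1, w.2.2.1, w.2.2.2.1, w.2.2.2.2, w.1)))
  exact (cartAux_contDiff hm).continuous.comp h1

lemma cartField_lip {m : ℝ} (hm : 0 < m) {u : ℝ → ℝ → ℝ → ℝ → ℝ → ℝ}
    (hu_cont : Continuous fun x : ℝ × ℝ × ℝ × ℝ × ℝ =>
      u x.1 x.2.1 x.2.2.1 x.2.2.2.1 x.2.2.2.2)
    (hu_lip : ∀ K : Set (ℝ × ℝ × ℝ × ℝ × ℝ), IsCompact K → ∃ L : ℝ,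
      ∀ a ∈ K, ∀ b ∈ K, a.2.2.2.2 = b.2.2.2.2 →
        |u a.1 a.2.1 a.2.2.1 a.2.2.2.1 a.2.2.2.2
          - u b.1 b.2.1 b.2.2.1 b.2.2.2.1 b.2.2.2.2| ≤
          L * dist ((a.1, a.2.1, a.2.2.1, a.2.2.2.1) : ℝ × ℝ × ℝ × ℝ)
                   ((b.1, b.2.1, b.2.2.1, b.2.2.2.1) : ℝ × ℝ × ℝ × ℝ)) :
    CartLip (cartField m u) := by
  intro a b R
  have hcomp := (isCompact_closedBall (0 : CartE) R).prod (isCompact_Icc (a := a) (b := b))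
  have hpc : Continuous (fun w : CartE × ℝ =>
      ((w.1.1, w.1.2.1, w.1.2.2.1, w.1.2.2.2, w.2) : ℝ × ℝ × ℝ × ℝ × ℝ)) := by fun_prop
  obtain ⟨L, hL⟩ := hu_lip _ (hcomp.image hpc)
  have hvc : Continuous (fun w : CartE × ℝ =>
      (w.1, u w.1.1 w.1.2.1 w.1.2.2.1 w.1.2.2.2 w.2)) :=
    continuous_fst.prodMk (hu_cont.comp hpc)
  obtain ⟨K, hK⟩ := ((cartAux_contDiff hm).locallyLipschitz.locallyLipschitzOn
    (s := _)).exists_lipschitzOnWith_of_compact (hcomp.image hvc)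
  refine ⟨K * max 1 (Real.toNNReal L), fun t ht => ?_⟩
  have hg : LipschitzOnWith (max 1 (Real.toNNReal L))
      (fun z : CartE => (z, u z.1 z.2.1 z.2.2.1 z.2.2.2 t)) (Metric.closedBall 0 R) := by
    refine LipschitzWith.id.lipschitzOnWith.prodMk ?_
    refine LipschitzOnWith.of_dist_le_mul (fun z hz w hw => ?_)
    have := hL _ ⟨(z, t), ⟨hz, ht⟩, rfl⟩ _ ⟨(w, t), ⟨hw, ht⟩, rfl⟩ rfl
    rw [Real.dist_eq]
    refine this.trans ?_
    exact mul_le_mul_of_nonneg_right (Real.le_coe_toNNReal L) dist_nonneg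
  exact hK.comp hg (fun z hz => ⟨(z, t), ⟨hz, ht⟩, rfl⟩)

lemma cart_exit {f : ℝ → CartE → CartE} (hfc : Continuous (Function.uncurry f))
    (hf : CartLip f) {a b : ℝ} (hab : a ≤ b) {z : ℝ → CartE} (hz : CartSol f a b z)
    {φ ψ : CartE → ℝ} {χ : ℝ → CartE → ℝ}
    (hφ : ∀ c w, CartSol f a c w → ∀ t ∈ Icc a c,
      HasDerivWithinAt (fun t => φ (w t)) (ψ (w t)) (Icc a c) t)
    (hψ : ∀ c w, CartSol f a c w → ∀ t ∈ Icc a c,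
      HasDerivWithinAt (fun t => ψ (w t)) (χ t (w t)) (Icc a c) t)
    (hχ : ∀ t x, φ x = 0 → χ t x < 0)
    {G : Set CartE} (hG : IsOpen G) (hzG : ∀ t ∈ Icc a b, z t ∈ G)
    (hb : φ (z b) ≤ 0) (hpos : ∀ t ∈ Ico a b, 0 < φ (z t)) (ha : ψ (z a) ≤ 0) :
    z a ∈ cartReach f a G {x | φ x < 0} := by
  rcases lt_or_eq_of_le hb with hlt | heq
  · exact ⟨b, z, hab, hz, rfl, hzG, hlt⟩
  have hψb : ψ (z b) ≤ 0 := by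
    rcases eq_or_lt_of_le hab with h | h
    · rwa [← h]
    · exact cart_left_deriv h (hφ b z hz b ⟨hab, le_rfl⟩) heq hpos
  obtain ⟨ε, hε, C, hC, w, hw, H⟩ := cart_flow_box hfc hf hab hz
  obtain ⟨w0, ws, -⟩ := H (z a) (Metric.mem_ball_self hε)
  set v := w (z a) with hv
  have hvb : v b = z b := hw b ⟨hab, le_rfl⟩
  have hbε : b < b + ε := by linarith
  obtain ⟨δ, hδ, hδε, hneg⟩ := cart_cross hab hbε (hφ _ v ws) (hψ _ v ws) (by rw [hvb, heq])
    (by rw [hvb]; exact hψb) (hχ _ _ (by rw [hvb, heq]))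
  have hGb : v ⁻¹' G ∈ nhdsWithin b (Icc a (b + ε)) :=
    (ws.cont b ⟨hab, hbε.le⟩) (hG.mem_nhds (by rw [hvb]; exact hzG b ⟨hab, le_rfl⟩))
  obtain ⟨η, hη, hηG⟩ := Metric.mem_nhdsWithin_iff.1 hGb
  set d := min δ (η / 2) with hd
  have hd0 : 0 < d := by positivity
  have hd1 : d ≤ δ := min_le_left _ _
  have hd2 : d ≤ η / 2 := min_le_right _ _
  refine ⟨b + d, v, by linarith, ws.mono (by linarith), w0, fun t ht => ?_,
    hneg _ ⟨by linarith, by linarith⟩⟩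
  rcases le_total t b with h | h
  · rw [hw t ⟨ht.1, h⟩]; exact hzG t ⟨ht.1, h⟩
  · refine hηG ⟨?_, ht.1, by linarith [ht.2]⟩
    rw [Metric.mem_ball, Real.dist_eq, abs_of_nonneg (by linarith)]
    linarith [ht.2]

lemma cart_first {g : ℝ → ℝ} {a b : ℝ} (hg : ContinuousOn g (Icc a b))
    (h : ∃ t ∈ Icc a b, ¬ (0 < g t ∧ g t < π)) :
    ∃ τ ∈ Icc a b, (g τ ≤ 0 ∨ π ≤ g τ) ∧ ∀ t ∈ Ico a τ, 0 < g t ∧ g t < π := by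
  set S := Icc a b ∩ g ⁻¹' (Ioo 0 π)ᶜ with hS
  have hSc : IsClosed S :=
    hg.preimage_isClosed_of_isClosed isClosed_Icc isOpen_Ioo.isClosed_compl
  have hSne : S.Nonempty := by
    obtain ⟨t, ht, h⟩ := h
    exact ⟨t, ht, h⟩
  have hSb : BddBelow S := ⟨a, fun t ht => ht.1.1⟩
  have hm : sInf S ∈ S := hSc.csInf_mem hSne hSb
  refine ⟨sInf S, hm.1, ?_, fun t ht => ?_⟩
  · have h2 : ¬ (0 < g (sInf S) ∧ g (sInf S) < π) := hm.2
    by_contra hcon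
    push Not at hcon
    exact h2 hcon
  · by_contra hcon
    exact absurd (csInf_le hSb ⟨⟨ht.1, ht.2.le.trans hm.1.2⟩, hcon⟩) (not_le.2 ht.2)

lemma cart_stay {m : ℝ} (hm : 0 < m) {u : ℝ → ℝ → ℝ → ℝ → ℝ → ℝ}
    (hfc : Continuous (Function.uncurry (cartField m u)))
    (hf : CartLip (cartField m u)) {a b : ℝ} (hab : a ≤ b)
    {z : ℝ → CartE} (hz : CartSol (cartField m u) a b z) (hp : (z a).2.1 = 0)
    (h0 : z a ∉ cartReach (cartField m u) a {x | x.1 < π} {x | x.1 < 0})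
    (h1 : z a ∉ cartReach (cartField m u) a {x | 0 < x.1} {x | π < x.1}) :
    ∀ t ∈ Icc a b, 0 < (z t).1 ∧ (z t).1 < π := by
  have d1 : ∀ c w, CartSol (cartField m u) a c w → ∀ t ∈ Icc a c,
      HasDerivWithinAt (fun t => (w t).1) ((w t).2.1) (Icc a c) t := fun c w hw t ht =>
    (hw t ht).fst
  have d2 : ∀ c w, CartSol (cartField m u) a c w → ∀ t ∈ Icc a c,
      HasDerivWithinAt (fun t => (w t).2.1) (cartPAcc m u (w t) t) (Icc a c) t :=
    fun c w hw t ht => (hw t ht).snd.fst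
  have hpi := Real.pi_pos
  by_contra hcon
  push Not at hcon
  obtain ⟨τ, hτ, hor, hbef⟩ := cart_first (g := fun t => (z t).1)
    (continuous_fst.comp_continuousOn hz.cont)
    (by obtain ⟨t, ht, h⟩ := hcon; exact ⟨t, ht, fun hh => absurd hh.2 (not_lt.2 (h hh.1))⟩)
  have hzτ := hz.mono hτ.2
  rcases hor with h | h
  · refine h0 (cart_exit hfc hf hτ.1 hzτ (φ := fun x => x.1) (ψ := fun x => x.2.1)
      (χ := fun t x => cartPAcc m u x t) d1 d2 ?_
      (isOpen_lt continuous_fst continuous_const) ?_ h (fun t ht => (hbef t ht).1) hp.le)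
    · intro t x hx
      simp only [cartPAcc, hx]
      have : 0 < 1 + m := by linarith
      simp
      apply div_neg_of_neg_of_pos <;> linarith
    · intro t ht
      rcases eq_or_lt_of_le ht.2 with halt | halt
      · rw [halt]
        exact lt_of_le_of_lt h hpi
      · exact (hbef t ⟨ht.1, halt⟩).2
  · have := cart_exit hfc hf hτ.1 hzτ (φ := fun x => π - x.1) (ψ := fun x => -x.2.1)
      (χ := fun t x => -cartPAcc m u x t) (fun c w hw t ht => (d1 c w hw t ht).const_sub π)
      (fun c w hw t ht => (d2 c w hw t ht).neg) ?_ (G := {x | 0 < x.1})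
      (isOpen_lt continuous_const continuous_fst) ?_ (by linarith)
      (fun t ht => by linarith [(hbef t ht).2]) (by simp [hp])
    · refine h1 ?_
      convert this using 2
      ext x
      simp
    · intro t x hx
      have hx' : x.1 = π := by linarith
      simp only [cartPAcc, hx']
      simp
      apply div_pos <;> linarith
    · intro t ht
      rcases eq_or_lt_of_le ht.2 with halt | halt
      · rw [halt]
        exact lt_of_lt_of_le hpi h
      · exact (hbef t ⟨ht.1, halt⟩).1

/-- For the pendulum on a cart with cart mass `m > 0`, if `μ ∈ M = {0 < q < π}` is an
equilibrium admitting a Lyapunov function satisfying L1 and L2 on a closed set `U ⊆ M`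
with `μ` in its interior, then there exist an initial condition with `0 < q₀ < π` and an
open neighborhood `B ⊆ M` of `μ` such that every solution starting there at `t₀` stays in
`M \ B` for all `t ≥ t₀` in its interval of existence. -/
theorem cart_pendulum_no_global_stabilization
    (m : ℝ) (hm : 0 < m)
    (u : ℝ → ℝ → ℝ → ℝ → ℝ → ℝ)
    (hu_cont : Continuous fun x : ℝ × ℝ × ℝ × ℝ × ℝ =>
      u x.1 x.2.1 x.2.2.1 x.2.2.2.1 x.2.2.2.2)
    (hu_lip : ∀ K : Set (ℝ × ℝ × ℝ × ℝ × ℝ), IsCompact K → ∃ L : ℝ,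
      ∀ a ∈ K, ∀ b ∈ K, a.2.2.2.2 = b.2.2.2.2 →
        |u a.1 a.2.1 a.2.2.1 a.2.2.2.1 a.2.2.2.2
          - u b.1 b.2.1 b.2.2.1 b.2.2.2.1 b.2.2.2.2| ≤
          L * dist ((a.1, a.2.1, a.2.2.1, a.2.2.2.1) : ℝ × ℝ × ℝ × ℝ)
                   ((b.1, b.2.1, b.2.2.1, b.2.2.2.1) : ℝ × ℝ × ℝ × ℝ))
    (μ : ℝ × ℝ × ℝ × ℝ) (hμM : 0 < μ.1 ∧ μ.1 < π)
    (hμrest : μ.2.1 = 0 ∧ μ.2.2.2 = 0)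
    (hμequil : ∀ t : ℝ, cartPAcc m u μ t = 0 ∧ cartYAcc m u μ t = 0)
    (t₀ : ℝ)
    (U : Set (ℝ × ℝ × ℝ × ℝ)) (hUclosed : IsClosed U)
    (hUM : U ⊆ {z : ℝ × ℝ × ℝ × ℝ | 0 < z.1 ∧ z.1 < π})
    (hμint : μ ∈ interior U)
    (V : ℝ × ℝ × ℝ × ℝ → ℝ) (DV : ℝ × ℝ × ℝ × ℝ → (ℝ × ℝ × ℝ × ℝ) →L[ℝ] ℝ)
    (hVdiff : ∀ z ∈ U, HasFDerivAt V (DV z) z)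
    (hDVcont : ContinuousOn DV U)
    (hL1a : V μ = 0)
    (hL1b : ∀ z ∈ U, z ≠ μ → 0 < V z)
    (hL2 : ∀ t : ℝ, ∀ z ∈ U, z ≠ μ →
      DV z (z.2.1, cartPAcc m u z t, z.2.2.2, cartYAcc m u z t) < 0) :
    ∃ (q₀ p₀ x₀ y₀ : ℝ) (B : Set (ℝ × ℝ × ℝ × ℝ)),
      0 < q₀ ∧ q₀ < π ∧
      IsOpen B ∧ μ ∈ B ∧ B ⊆ {z : ℝ × ℝ × ℝ × ℝ | 0 < z.1 ∧ z.1 < π} ∧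
      ∀ I : Set ℝ, t₀ ∈ I → I.OrdConnected →
        ∀ q p x y : ℝ → ℝ,
          (∀ t ∈ I, HasDerivWithinAt q (p t) I t) →
          (∀ t ∈ I, HasDerivWithinAt p (cartPAcc m u (q t, p t, x t, y t) t) I t) →
          (∀ t ∈ I, HasDerivWithinAt x (y t) I t) →
          (∀ t ∈ I, HasDerivWithinAt y (cartYAcc m u (q t, p t, x t, y t) t) I t) →
          q t₀ = q₀ → p t₀ = p₀ → x t₀ = x₀ → y t₀ = y₀ →
          ∀ t ∈ I, t₀ ≤ t →
            (0 < q t ∧ q t < π) ∧ (q t, p t, x t, y t) ∉ B := by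
  have hfc := cartField_cont hm hu_cont
  have hf := cartField_lip hm hu_cont hu_lip
  have hpi := Real.pi_pos
  have hneg : ∀ t, ∀ x ∈ U, DV x (cartField m u t x) ≤ 0 := by
    intro t x hx
    by_cases hxμ : x = μ
    · have : cartField m u t x = 0 := by
        subst hxμ
        simp only [cartField, (hμequil t).1, (hμequil t).2, hμrest.1, hμrest.2]
        rfl
      rw [this, map_zero]
    · exact (hL2 t x hx hxμ).le
  obtain ⟨r, hr, hrU⟩ := Metric.nhds_basis_closedBall.mem_iff.1 (mem_interior_iff_mem_nhds.1 hμint)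
  have hVc : ContinuousOn V (Metric.closedBall μ r) := fun x hx =>
    (hVdiff x (hrU hx)).continuousAt.continuousWithinAt
  obtain ⟨c, hc0, hc⟩ : ∃ c > 0, ∀ x ∈ Metric.sphere μ r, c ≤ V x := by
    obtain ⟨x, hx, hmin⟩ := (isCompact_sphere μ r).exists_isMinOn
      (NormedSpace.sphere_nonempty.2 hr.le) (hVc.mono Metric.sphere_subset_closedBall)
    refine ⟨V x, hL1b x (hrU (Metric.sphere_subset_closedBall hx)) ?_, fun y hy => hmin hy⟩
    rintro rfl
    simp at hx
    linarith
  set B : Set CartE := {x | x ∈ Metric.ball μ r ∧ V x < c} with hB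
  have hBo : IsOpen B :=
    (hVc.mono Metric.ball_subset_closedBall).isOpen_inter_preimage Metric.isOpen_ball isOpen_Iio
  have hBM : B ⊆ {z : ℝ × ℝ × ℝ × ℝ | 0 < z.1 ∧ z.1 < π} := fun x hx =>
    hUM (hrU (Metric.ball_subset_closedBall hx.1))
  set f := cartField m u with hfdef
  set R0 := cartReach f t₀ {x | x.1 < π} {x | x.1 < 0} with hR0
  set R1 := cartReach f t₀ {x | 0 < x.1} {x | π < x.1} with hR1
  set R2 := cartReach f t₀ {x | 0 < x.1 ∧ x.1 < π} B with hR2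
  have o0 : IsOpen R0 := cartReach_open hfc hf t₀ (isOpen_lt continuous_fst continuous_const)
    (isOpen_lt continuous_fst continuous_const)
  have o1 : IsOpen R1 := cartReach_open hfc hf t₀ (isOpen_lt continuous_const continuous_fst)
    (isOpen_lt continuous_const continuous_fst)
  have o2 : IsOpen R2 := cartReach_open hfc hf t₀ ((isOpen_lt continuous_const continuous_fst).inter
    (isOpen_lt continuous_fst continuous_const)) hBo
  have hconst : ∀ ξ : CartE, CartSol f t₀ t₀ (fun _ => ξ) := by
    intro ξ t ht
    rw [Icc_self] at ht ⊢
    rw [mem_singleton_iff.1 ht]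
    exact hasDerivWithinAt_iff_hasFDerivWithinAt.2 HasFDerivWithinAt.singleton
  have dis : Disjoint R0 (R1 ∪ R2) := by
    rw [Set.disjoint_left]
    rintro ξ ⟨b, z, hab, hz, hz0, hzG, hzW⟩ (⟨balt, zalt, hab', hz', hz0', hzG', hzW'⟩ |
      ⟨balt, zalt, hab', hz', hz0', hzG', hzW'⟩)
    · rcases le_total b balt with h | h
      · have e := hz.unique hf (hz'.mono h) (hz0.trans hz0'.symm) b ⟨hab, le_rfl⟩
        have := hzG' b ⟨hab, h⟩
        rw [← e] at this
        have h2 : (z b).1 < 0 := hzW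
        exact lt_asymm (show 0 < (z b).1 from this) h2
      · have e := (hz.mono h).unique hf hz' (hz0.trans hz0'.symm) balt ⟨hab', le_rfl⟩
        have := hzG balt ⟨hab', h⟩
        rw [e] at this
        have h2 : π < (zalt balt).1 := hzW'
        exact lt_asymm (show (zalt balt).1 < π from this) h2
    · rcases le_total b balt with h | h
      · have e := hz.unique hf (hz'.mono h) (hz0.trans hz0'.symm) b ⟨hab, le_rfl⟩
        have := (hzG' b ⟨hab, h⟩).1
        rw [← e] at this
        have h2 : (z b).1 < 0 := hzW
        exact lt_asymm (show 0 < (z b).1 from this) h2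
      · have e := (hz.mono h).unique hf hz' (hz0.trans hz0'.symm) balt ⟨hab', le_rfl⟩
        rw [← e] at hzW'
        have := cart_inv hz hVdiff hneg hrU hc hab' h hzW'
        have h2 : (z b).1 < 0 := hzW
        exact lt_asymm (hBM this).1 h2
  have hγ : Continuous (fun s : ℝ => ((s, 0, 0, 0) : CartE)) := by fun_prop
  obtain ⟨s, hs⟩ : ∃ s : ℝ, ((s, 0, 0, 0) : CartE) ∉ R0 ∪ (R1 ∪ R2) := by
    by_contra hcon
    push Not at hcon
    have hsub := IsPreconnected.subset_left_of_subset_union (s := (univ : Set ℝ))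
      (o0.preimage hγ) ((o1.union o2).preimage hγ) (dis.preimage _) (fun s _ => hcon s)
      ⟨-1, mem_univ _, t₀, fun _ => (-1, 0, 0, 0), le_rfl, hconst _, rfl,
        fun t _ => by simp only [mem_ofPred_eq]; linarith, by simp⟩ isPreconnected_univ
    have h1 : ((π + 1, 0, 0, 0) : CartE) ∈ R0 := hsub (mem_univ (π + 1))
    refine Set.disjoint_left.1 dis h1 (Or.inl ?_)
    exact ⟨t₀, fun _ => (π + 1, 0, 0, 0), le_rfl, hconst _, rfl,
        fun t _ => by simp only [mem_ofPred_eq]; linarith, by simp⟩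
  simp only [mem_union, not_or] at hs
  obtain ⟨hs0, hs1, hs2⟩ := hs
  have hs01 := cart_stay hm hfc hf le_rfl (hconst (s, 0, 0, 0)) rfl hs0 hs1 t₀ ⟨le_rfl, le_rfl⟩
  refine ⟨s, 0, 0, 0, B, hs01.1, hs01.2, hBo, ⟨Metric.mem_ball_self hr, by rw [hL1a]; exact hc0⟩,
    hBM, ?_⟩
  intro I hI hIo q p x y hq hp hx hy hq0 hp0 hx0 hy0 t ht hle
  have hsub : Icc t₀ t ⊆ I := hIo.out hI ht
  have hz : CartSol f t₀ t (fun t => (q t, p t, x t, y t)) := by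
    intro τ hτ
    have hτI := hsub hτ
    exact ((hq τ hτI).prodMk ((hp τ hτI).prodMk ((hx τ hτI).prodMk (hy τ hτI)))).mono hsub
  have hz0 : (fun t => ((q t, p t, x t, y t) : CartE)) t₀ = (s, 0, 0, 0) := by
    simp [hq0, hp0, hx0, hy0]
  have hst := cart_stay hm hfc hf hle hz hp0 (by simp only [hq0, hp0, hx0, hy0]; exact hs0) (by simp only [hq0, hp0, hx0, hy0]; exact hs1)
  exact ⟨hst t ⟨hle, le_rfl⟩, fun hBt => hs2 ⟨t, _, hle, hz, hz0, hst, hBt⟩⟩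
end
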